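/- arXiv:1501.00602 — 4 statements merged into one kernel-verified Lean document; each statement's English description precedes it below -/
import Mathlib

section
/- Let L/F be an extension with no proper finite intermediate extension, and let S, T be F-subspaces of L with dim(S), dim(T) ≥ 2. If S has a basis {g, ga, …, g a^{s−1}} and dim(ST) = dim(S) + dim(T) − 1 ≤ dim(L) − 1, then T has a basis of the form {g′, g′a, …, g′ a^{t−1}} for some g′ ∈ L, with the same ratio a. -/
open Module Submodule
open scoped Pointwise

/-- If `L / F` has no proper finite intermediate extension, then the powers of an element outside
`F` are as independent as the degree of `L / F` permits. -/
theorem linearIndependent_pow_of_no_finite_intermediate {F L : Type*} [Field F] [Field L]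
    [Algebra F L]
    (hL : ∀ K : IntermediateField F L, FiniteDimensional F ↥K → K = ⊥ ∨ K = ⊤)
    {a : L} (ha : a ∉ Set.range (algebraMap F L)) {n : ℕ} (hn : (n : Cardinal) ≤ Module.rank F L) :
    LinearIndependent F fun i : Fin n => a ^ (i : ℕ) := by
  by_cases hint : IsIntegral F a
  · have htop : IntermediateField.adjoin F {a} = ⊤ := by
      refine (hL _ (IntermediateField.adjoin.finiteDimensional hint)).resolve_left fun h => ha ?_
      exact IntermediateField.mem_bot.1 (IntermediateField.adjoin_simple_eq_bot_iff.1 h)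
    have hfin : FiniteDimensional F L := by
      have := IntermediateField.adjoin.finiteDimensional hint
      rw [htop] at this
      exact Module.Finite.equiv IntermediateField.topEquiv.toLinearEquiv
    have hdeg : (minpoly F a).natDegree = finrank F L := by
      rw [← IntermediateField.adjoin.finrank hint, htop, IntermediateField.finrank_top']
    rw [← finrank_eq_rank, Nat.cast_le, ← hdeg] at hn
    exact (linearIndependent_pow a).comp (Fin.castLE hn) (Fin.castLE_injective hn)
  · have htr : Transcendental F a := fun h => hint h.isIntegral
    have hpow := (Polynomial.basisMonomials F).linearIndependent.map'
      (Polynomial.aeval a).toLinearMap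
      (LinearMap.ker_eq_bot.2 (transcendental_iff_injective.1 htr))
    simpa [Function.comp_def] using hpow.comp _ (Fin.val_injective (n := n))

/-- A nonzero finite-dimensional subspace is not stable under multiplication by an
element with sufficiently many independent powers. -/
theorem exists_mul_notMem_of_linearIndependent_pow {F L : Type*} [Field F] [Field L] [Algebra F L]
    {a : L} {U : Submodule F L} [FiniteDimensional F U] (hU : U ≠ ⊥)
    (hli : LinearIndependent F fun i : Fin (finrank F U + 1) => a ^ (i : ℕ)) :
    ∃ x ∈ U, a * x ∉ U := by
  by_contra! hstab
  obtain ⟨u, hu, hu0⟩ := exists_mem_ne_zero_of_ne_bot hU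
  have hmem (i : ℕ) : u * a ^ i ∈ U := by
    induction i with
    | zero => simpa using hu
    | succ i ih => simpa [pow_succ, mul_comm, mul_left_comm] using hstab _ ih
  have hli' : LinearIndependent F
      fun i : Fin (finrank F U + 1) => (⟨u * a ^ (i : ℕ), hmem i⟩ : U) := by
    refine LinearIndependent.of_comp U.subtype ?_
    exact hli.map' (LinearMap.mulLeft F u)
      (LinearMap.ker_eq_bot.2 (mul_right_injective₀ hu0))
  simpa using hli'.fintype_card_le_finrank

theorem exists_pow_eq_of_mem_pair_pow {M : Type*} [CommMonoid M] {a x : M} {k : ℕ}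
    (hx : x ∈ ({1, a} : Set M) ^ k) : ∃ i ≤ k, x = a ^ i := by
  induction k generalizing x with
  | zero => exact ⟨0, le_rfl, by simpa using hx⟩
  | succ k ih =>
    rw [pow_succ] at hx
    obtain ⟨y, hy, z, hz, rfl⟩ := Set.mem_mul.1 hx
    obtain ⟨i, hi, rfl⟩ := ih hy
    rcases hz with rfl | rfl
    · exact ⟨i, by omega, by simp⟩
    · exact ⟨i + 1, by omega, (pow_succ _ _).symm⟩

theorem finrank_map_mulLeft {F L : Type*} [Field F] [Field L] [Algebra F L] {a : L} (ha : a ≠ 0)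
    (U : Submodule F L) : finrank F (U.map (LinearMap.mulLeft F a)) = finrank F U :=
  (U.equivMapOfInjective _ (mul_right_injective₀ ha)).finrank_eq.symm

/-- If `T + aT` has dimension at most `dim T + 1`, then `T` contains a subspace of codimension at
most `k` whose translates by `1, a, …, a ^ k` all lie in `T`. -/
theorem exists_le_forall_mul_pow_mem {F L : Type*} [Field F] [Field L] [Algebra F L]
    {a : L} (ha : a ≠ 0) {T : Submodule F L} [FiniteDimensional F T]
    (hT : finrank F ↥(T.map (LinearMap.mulLeft F a) ⊔ T) ≤ finrank F T + 1) (k : ℕ) :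
    ∃ W ≤ T, finrank F T ≤ finrank F W + k ∧ ∀ x ∈ W, ∀ i ≤ k, x * a ^ i ∈ T := by
  induction k with
  | zero =>
    refine ⟨T, le_rfl, le_rfl, fun x hx i hi => ?_⟩
    obtain rfl : i = 0 := by omega
    simpa using hx
  | succ k ih =>
    obtain ⟨W, hWT, hdim, hW⟩ := ih
    have : FiniteDimensional F W := Submodule.finiteDimensional_of_le hWT
    refine ⟨T ⊓ W.comap (LinearMap.mulLeft F a), inf_le_left, ?_, ?_⟩
    · have hinf := finrank_sup_add_finrank_inf_eq (T.map (LinearMap.mulLeft F a)) W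
      rw [map_inf_eq_map_inf_comap, finrank_map_mulLeft ha,
        finrank_map_mulLeft ha] at hinf
      have := Submodule.finrank_mono (sup_le_sup_left hWT (T.map (LinearMap.mulLeft F a)))
      omega
    · rintro x ⟨hxT, hxW⟩ i hi
      cases i with
      | zero => simpa using hxT
      | succ i =>
        have := hW _ hxW i (by omega)
        rwa [LinearMap.mulLeft_apply, mul_comm a, mul_assoc, ← pow_succ'] at this

theorem stmt3 {F L : Type*} [Field F] [Field L] [Algebra F L]
    (hL : ∀ K : IntermediateField F L, FiniteDimensional F ↥K → K = ⊥ ∨ K = ⊤)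
    (S T : Submodule F L)
    [FiniteDimensional F ↥S] [FiniteDimensional F ↥T]
    (hS2 : 2 ≤ finrank F ↥S) (hT2 : 2 ≤ finrank F ↥T)
    (g a : L) (bS : Basis (Fin (finrank F ↥S)) F ↥S)
    (hbS : ∀ i, (bS i : L) = g * a ^ (i : ℕ))
    (hST : finrank F ↥(S * T) = finrank F ↥S + finrank F ↥T - 1)
    (hup : ((finrank F ↥S + finrank F ↥T : ℕ) : Cardinal) ≤ Module.rank F L) :
    ∃ g' : L, ∃ bT : Basis (Fin (finrank F ↥T)) F ↥T,
      ∀ i, (bT i : L) = g' * a ^ (i : ℕ) := by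
  have hS (i : ℕ) (hi : i < finrank F S) : g * a ^ i ∈ S := hbS ⟨i, hi⟩ ▸ (bS ⟨i, hi⟩).2
  have hg : g ≠ 0 := by
    rintro rfl
    exact bS.ne_zero ⟨0, by omega⟩ (Subtype.ext (by simp [hbS]))
  have ha : a ∉ Set.range (algebraMap F L) := by
    rintro ⟨c, rfl⟩
    have h : bS ⟨1, by omega⟩ = c • bS ⟨0, by omega⟩ :=
      Subtype.ext (by simp [hbS, Algebra.smul_def, mul_comm])
    have h1 := congrArg (fun v => bS.repr v ⟨1, by omega⟩) h
    simp at h1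
  have ha0 : a ≠ 0 := fun h => ha ⟨0, by simp [h]⟩
  have hli {n : ℕ} (hn : n ≤ finrank F S + finrank F T) :
      LinearIndependent F fun i : Fin n => a ^ (i : ℕ) :=
    linearIndependent_pow_of_no_finite_intermediate hL ha ((Nat.cast_le.2 hn).trans hup)
  have hTbot : T ≠ ⊥ := by
    rintro rfl
    simp at hT2
  let B : Submodule F L := span F {1, a}
  have hBfin : B.FG := fg_span (by simp)
  have hTfin : T.FG := Module.Finite.iff_fg.1 inferInstance
  have hfin (k : ℕ) : FiniteDimensional F ↥(B ^ k * T) :=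
    Module.Finite.iff_fg.2 ((hBfin.pow k).mul hTfin)
  have h1B : (1 : L) ∈ B := subset_span (by simp)
  have haB : a ∈ B := subset_span (by simp)
  have hmono (k : ℕ) : B ^ k * T ≤ B ^ (k + 1) * T := by
    intro x hx
    rw [pow_succ', mul_assoc]
    simpa using mul_mem_mul h1B hx
  have hTle (k : ℕ) : T ≤ B ^ k * T := by
    induction k with
    | zero => simp
    | succ k ih => exact ih.trans (hmono k)
  -- As long as `B ^ k * T` is not all of `L`, multiplying by `B` raises its dimension.
  have hlt (k : ℕ) (hk : finrank F ↥(B ^ k * T) < finrank F S + finrank F T) :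
      finrank F ↥(B ^ k * T) < finrank F ↥(B ^ (k + 1) * T) := by
    refine Submodule.finrank_lt_finrank_of_lt ((hmono k).lt_of_ne fun h => ?_)
    obtain ⟨x, hx, hax⟩ := exists_mul_notMem_of_linearIndependent_pow
      (ne_bot_of_le_ne_bot hTbot (hTle k)) (hli hk)
    refine hax ?_
    rw [h, pow_succ', mul_assoc]
    exact mul_mem_mul haB hx
  have htop : finrank F ↥(B ^ (finrank F S - 1) * T) ≤ finrank F S + finrank F T - 1 := by
    have : FiniteDimensional F ↥(S * T) :=
      Module.Finite.iff_fg.2 ((Module.Finite.iff_fg.1 inferInstance).mul hTfin)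
    rw [← hST, ← finrank_map_mulLeft hg]
    refine Submodule.finrank_mono (map_le_iff_le_comap.2 (mul_le.2 fun x hx y hy => ?_))
    have hxS : B ^ (finrank F S - 1) ≤ S.comap (LinearMap.mulLeft F g) := by
      rw [span_pow, span_le]
      intro z hz
      obtain ⟨i, hi, rfl⟩ := exists_pow_eq_of_mem_pair_pow hz
      exact hS i (by omega)
    rw [mem_comap, LinearMap.mulLeft_apply, ← mul_assoc]
    exact mul_mem_mul (hxS hx) hy
  have hgrow (j : ℕ) (hj : finrank F ↥(B ^ (j + 1) * T) < finrank F S + finrank F T) :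
      finrank F ↥(B * T) + j ≤ finrank F ↥(B ^ (j + 1) * T) := by
    induction j with
    | zero => rw [zero_add, pow_one, add_zero]
    | succ j ih =>
      have hle := Submodule.finrank_mono (hmono (j + 1))
      have := ih (by omega)
      have := hlt (j + 1) (by omega)
      omega
  have hBT : finrank F ↥(B * T) ≤ finrank F T + 1 := by
    have := hgrow (finrank F S - 2)
    rw [show finrank F S - 2 + 1 = finrank F S - 1 by omega] at this
    have := this (by omega)
    omega
  have hsup : T.map (LinearMap.mulLeft F a) ⊔ T ≤ B * T := by
    refine sup_le ?_ (by simpa only [pow_one] using hTle 1)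
    rintro _ ⟨x, hx, rfl⟩
    exact mul_mem_mul haB hx
  have : FiniteDimensional F ↥(B * T) := Module.Finite.iff_fg.2 (hBfin.mul hTfin)
  obtain ⟨W, hWT, hdim, hW⟩ := exists_le_forall_mul_pow_mem ha0
    ((Submodule.finrank_mono hsup).trans hBT) (finrank F T - 1)
  have hWbot : W ≠ ⊥ := by
    rintro rfl
    simp at hdim
    omega
  obtain ⟨g', hg'W, hg'⟩ := exists_mem_ne_zero_of_ne_bot hWbot
  have hliT : LinearIndependent F
      fun i : Fin (finrank F T) => (⟨g' * a ^ (i : ℕ), hW g' hg'W i (by omega)⟩ : T) := by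
    refine LinearIndependent.of_comp T.subtype ?_
    exact (hli (by omega)).map' (LinearMap.mulLeft F g')
      (LinearMap.ker_eq_bot.2 (mul_right_injective₀ hg'))
  have : Nonempty (Fin (finrank F T)) := ⟨⟨0, by omega⟩⟩
  exact ⟨g', basisOfLinearIndependentOfCardEqFinrank hliT (by simp), fun i => by simp⟩
end

section
/- Under the same hypotheses, if A is a 2-atom of S then for every integer t ≥ 2, dim(A^t) = min{dim(A^{t−1}) + dim(A) − 1, dim(L)}, where A^t = A·A^{t−1}. -/
open Module Submodule

variable {F L : Type*} [Field F] [Field L] [Algebra F L]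

/-- The boundary `∂_S X = dim(XS) - dim(X)` (as an integer). -/
noncomputable def deltaS (S X : Submodule F L) : ℤ :=
  (finrank F ↥(X * S) : ℤ) - finrank F ↥X

/-- Membership in the family `𝒳_k`: `k ≤ dim X < ∞` and `dim(XS) + k ≤ dim L`. -/
def InXk (k : ℕ) (S X : Submodule F L) : Prop :=
  FiniteDimensional F ↥X ∧ k ≤ finrank F ↥X ∧
    ((finrank F ↥(X * S) + k : ℕ) : Cardinal) ≤ Module.rank F L

/-- A `k`-fragment of `S`: an element of `𝒳_k` attaining the minimum `κ_k(S)` of `∂_S`. -/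
def IsFragment (k : ℕ) (S X : Submodule F L) : Prop :=
  InXk k S X ∧ ∀ Y : Submodule F L, InXk k S Y → deltaS S X ≤ deltaS S Y

/-- A `k`-atom of `S`: a `k`-fragment of minimum dimension. -/
def IsAtomk (k : ℕ) (S A : Submodule F L) : Prop :=
  IsFragment k S A ∧ ∀ B : Submodule F L, IsFragment k S B → finrank F ↥A ≤ finrank F ↥B

section Helpers

open scoped Pointwise

instance finiteDimensional_mul (A B : Submodule F L) [FiniteDimensional F A]
    [FiniteDimensional F B] : FiniteDimensional F ↥(A * B) :=
  Module.Finite.iff_fg.2 ((Module.Finite.iff_fg.1 ‹_›).mul (Module.Finite.iff_fg.1 ‹_›))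

instance finiteDimensional_smul (A : Submodule F L) [FiniteDimensional F A] (z : L) :
    FiniteDimensional F ↥(z • A) :=
  Module.Finite.iff_fg.2 ((Module.Finite.iff_fg.1 ‹_›).map _)

instance finiteDimensional_pow (A : Submodule F L) [FiniteDimensional F A] (t : ℕ) :
    FiniteDimensional F ↥(A ^ t) :=
  Module.Finite.iff_fg.2 ((Module.Finite.iff_fg.1 ‹_›).pow t)

theorem finrank_smul_eq (A : Submodule F L) {z : L} (hz : z ≠ 0) :
    finrank F ↥(z • A) = finrank F A :=
  (LinearEquiv.finrank_eq (Submodule.equivMapOfInjective (DistribSMul.toLinearMap F L z)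
    (fun _ _ h ↦ mul_left_cancel₀ hz h) A)).symm

theorem mem_smul_iff {A : Submodule F L} {z x : L} : x ∈ z • A ↔ ∃ a ∈ A, z * a = x :=
  Submodule.mem_smul_pointwise_iff_exists x z A

theorem smul_le_mul {A B : Submodule F L} {z : L} (hz : z ∈ A) : z • B ≤ A * B := by
  intro x hx
  obtain ⟨b, hb, rfl⟩ := mem_smul_iff.1 hx
  exact Submodule.mul_mem_mul hz hb

theorem natCast_le_rank_iff_finrank {n : ℕ} :
    (n : Cardinal) ≤ Module.rank F L ↔ (FiniteDimensional F L → n ≤ finrank F L) := by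
  by_cases h : FiniteDimensional F L
  · rw [← finrank_eq_rank, Nat.cast_le]
    exact ⟨fun h _ ↦ h, fun H ↦ H h⟩
  · refine ⟨fun _ h' ↦ absurd h' h, fun _ ↦ ?_⟩
    have : Cardinal.aleph0 ≤ Module.rank F L := by
      rw [← not_lt, Module.rank_lt_aleph0_iff]
      exact h
    exact (Cardinal.natCast_lt_aleph0).le.trans this

/-- Two elements of a subspace of dimension at least two whose ratio is not a scalar. -/
theorem exists_ratio_notMem {A : Submodule F L} (hA : 2 ≤ finrank F A) :
    ∃ x ∈ A, ∃ y ∈ A, x ≠ 0 ∧ y ≠ 0 ∧ y / x ∉ Set.range (algebraMap F L) := by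
  have : Nontrivial A := Module.nontrivial_of_finrank_pos (R := F) (by omega)
  obtain ⟨x, hx⟩ := exists_ne (0 : A)
  obtain ⟨y, hxy⟩ := exists_linearIndependent_pair_of_one_lt_finrank (R := F) (by omega) hx
  have hx0 : (x : L) ≠ 0 := fun h ↦ hx (Subtype.ext h)
  rw [LinearIndependent.pair_iff] at hxy
  refine ⟨x, x.2, y, y.2, hx0, ?_, ?_⟩
  · intro hy
    have := hxy 0 1 (Subtype.ext (by simp [hy]))
    simp at this
  · rintro ⟨c, hc⟩
    rw [eq_div_iff hx0] at hc
    have := hxy c (-1) (Subtype.ext (by simp [Algebra.smul_def, hc]))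
    simp at this

/-- Orthogonality for a nondegenerate form `(x, y) ↦ φ (x * y)` on a finite extension. -/
theorem exists_dual [FiniteDimensional F L] :
    ∃ P : Submodule F L → Submodule F L,
      (∀ X, finrank F ↥(P X) = finrank F L - finrank F X) ∧ ∀ X S, P (X * S) * S ≤ P X := by
  obtain ⟨φ, hφ⟩ := exists_ne (0 : Module.Dual F L)
  obtain ⟨w, hw⟩ : ∃ w, φ w ≠ 0 := by
    by_contra! h
    exact hφ (LinearMap.ext h)
  let b : LinearMap.BilinForm F L := (LinearMap.mul F L).compr₂ φ
  have hb : ∀ x y, b x y = φ (x * y) := fun _ _ ↦ rfl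
  have hnd : b.Nondegenerate := by
    constructor
    · intro x hx
      by_contra h0
      have := hx (x⁻¹ * w)
      rw [hb, mul_inv_cancel_left₀ h0] at this
      exact hw this
    · intro x hx
      by_contra h0
      have := hx (x⁻¹ * w)
      rw [hb, mul_comm, mul_inv_cancel_left₀ h0] at this
      exact hw this
  refine ⟨b.orthogonal, fun X ↦ LinearMap.BilinForm.finrank_orthogonal hnd X, fun X S ↦ ?_⟩
  rw [Submodule.mul_le]
  intro y hy s hs
  rw [LinearMap.BilinForm.mem_orthogonal_iff] at hy ⊢
  intro x hx
  have := hy (x * s) (Submodule.mul_mem_mul hx hs)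
  rw [hb] at this ⊢
  rwa [show x * (y * s) = x * s * y by ring]

/-- Only scalars stabilise a proper nonzero finite-dimensional subspace. -/
theorem mem_range_of_smul_eq
    (hL : ∀ K : IntermediateField F L, FiniteDimensional F ↥K → K = ⊥ ∨ K = ⊤)
    {A : Submodule F L} [FiniteDimensional F A] (h0 : A ≠ ⊥) (h1 : A ≠ ⊤) {z : L}
    (hz : z • A = A) : z ∈ Set.range (algebraMap F L) := by
  have hmem : ∀ a ∈ A, z * a ∈ A := fun a ha ↦ by
    rw [← hz]
    exact mem_smul_iff.2 ⟨a, ha, rfl⟩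
  have hint : IsIntegral F z :=
    isIntegral_of_smul_mem_submodule A h0 (Module.Finite.iff_fg.1 ‹_›) z hmem
  rcases hL (IntermediateField.adjoin F {z}) (IntermediateField.adjoin.finiteDimensional hint)
    with h | h
  · rw [← IntermediateField.mem_bot, ← h]
    exact IntermediateField.mem_adjoin_simple_self F z
  · exfalso
    have htop : Algebra.adjoin F {z} = ⊤ := by
      rw [← IntermediateField.adjoin_simple_toSubalgebra_of_isAlgebraic hint.isAlgebraic, h,
        IntermediateField.top_toSubalgebra]
    have hall : ∀ w : L, ∀ a ∈ A, w * a ∈ A := by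
      intro w
      have hw : w ∈ Algebra.adjoin F {z} := htop ▸ Algebra.mem_top
      induction hw using Algebra.adjoin_induction with
      | mem x hx => rw [Set.mem_singleton_iff.1 hx]; exact hmem
      | algebraMap r => intro a ha; rw [← Algebra.smul_def]; exact A.smul_mem r ha
      | add x y _ _ hx hy => intro a ha; rw [add_mul]; exact A.add_mem (hx a ha) (hy a ha)
      | mul x y _ _ hx hy => intro a ha; rw [mul_assoc]; exact hx _ (hy a ha)
    obtain ⟨a, ha, ha0⟩ := A.ne_bot_iff.1 h0
    refine h1 (eq_top_iff.2 fun w _ ↦ ?_)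
    have := hall (w / a) a ha
    rwa [div_mul_cancel₀ _ ha0] at this

theorem finrank_le_finrank_mul {S X : Submodule F L} [FiniteDimensional F S]
    [FiniteDimensional F X] (hS : S ≠ ⊥) : finrank F X ≤ finrank F ↥(X * S) := by
  obtain ⟨s, hs, hs0⟩ := S.ne_bot_iff.1 hS
  rw [← finrank_smul_eq X hs0, mul_comm]
  exact Submodule.finrank_mono (smul_le_mul hs)

theorem exists_isAtomk {k : ℕ} {S : Submodule F L} [FiniteDimensional F S] (hS : S ≠ ⊥)
    (h : ∃ X, InXk k S X) : ∃ A, IsAtomk k S A := by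
  have hfrag : ∃ X, IsFragment k S X := by
    obtain ⟨X, hX, hmin⟩ := exists_minimalFor_of_wellFoundedLT (InXk k S)
      (fun X ↦ finrank F ↥(X * S) - finrank F X) h
    refine ⟨X, hX, fun Y hY ↦ ?_⟩
    have := hX.1
    have := hY.1
    have h1 := finrank_le_finrank_mul (X := X) hS
    have h2 := finrank_le_finrank_mul (X := Y) hS
    have h3 := le_total (finrank F ↥(X * S) - finrank F X) (finrank F ↥(Y * S) - finrank F Y)
    have h4 : finrank F ↥(X * S) - finrank F X ≤ finrank F ↥(Y * S) - finrank F Y :=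
      h3.elim id (fun h ↦ hmin hY h)
    unfold deltaS
    omega
  obtain ⟨A, hA, hmin⟩ := exists_minimalFor_of_wellFoundedLT (IsFragment k S)
    (fun X ↦ finrank F X) hfrag
  exact ⟨A, hA, fun B hB ↦ (le_total _ _).elim id (fun h ↦ hmin hB h)⟩

/-- A `k`-atom meets each of its distinct translates in dimension less than `k`. -/
theorem IsAtomk.smul_eq {k : ℕ} {S A : Submodule F L} [FiniteDimensional F S] (hk : 1 ≤ k)
    (hA : IsAtomk k S A) {z : L} (hz : z ≠ 0) (hd : k ≤ finrank F ↥(A ⊓ z • A)) :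
    z • A = A := by
  obtain ⟨⟨⟨hfin, hkA, hrank⟩, hmin⟩, hatom⟩ := hA
  rw [natCast_le_rank_iff_finrank] at hrank
  have hzA := finrank_smul_eq A hz
  by_contra hne
  have hlt : finrank F ↥(A ⊓ z • A) < finrank F A := by
    refine lt_of_le_of_ne (Submodule.finrank_mono inf_le_left) fun h ↦ hne ?_
    have h1 : A ⊓ z • A = A := Submodule.eq_of_le_of_finrank_eq inf_le_left h
    exact (Submodule.eq_of_le_of_finrank_eq (inf_eq_left.1 h1) hzA.symm).symm
  have hsmul : (z • A) * S = z • (A * S) := smul_mul_assoc z A S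
  have hzAS : finrank F ↥((z • A) * S) = finrank F ↥(A * S) := by
    rw [hsmul, finrank_smul_eq _ hz]
  have hint : (A ⊓ z • A) * S ≤ A * S ⊓ (z • A) * S :=
    le_inf (mul_le_mul_left inf_le_left S) (mul_le_mul_left inf_le_right S)
  have hsup : (A ⊔ z • A) * S = A * S ⊔ (z • A) * S := Submodule.sup_mul _ _ _
  have d1 := Submodule.finrank_sup_add_finrank_inf_eq (A * S) ((z • A) * S)
  have d2 := Submodule.finrank_sup_add_finrank_inf_eq A (z • A)
  have d3 := Submodule.finrank_mono hint
  have d4 : finrank F ↥((A ⊓ z • A) * S) ≤ finrank F ↥(A * S) :=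
    Submodule.finrank_mono (hint.trans inf_le_left)
  rw [← hsup] at d1
  have hinX : InXk k S (A ⊓ z • A) :=
    ⟨inferInstance, hd, natCast_le_rank_iff_finrank.2 fun h ↦ by have := hrank h; omega⟩
  have hI : deltaS S A < deltaS S (A ⊓ z • A) := by
    refine lt_of_le_of_ne (hmin _ hinX) fun h ↦ ?_
    have := hatom _ ⟨hinX, fun Y hY ↦ h ▸ hmin Y hY⟩
    omega
  unfold deltaS at hI
  have hsupX : ¬ InXk k S (A ⊔ z • A) := by
    intro h
    have := hmin _ h
    unfold deltaS at this
    omega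
  have hbig : ¬ ((finrank F ↥((A ⊔ z • A) * S) + k : ℕ) : Cardinal) ≤ Module.rank F L :=
    fun h ↦ hsupX ⟨inferInstance, hkA.trans (Submodule.finrank_mono le_sup_left), h⟩
  rw [natCast_le_rank_iff_finrank] at hbig
  push Not at hbig
  obtain ⟨hLfin, hbig⟩ := hbig
  have hrank := hrank hLfin
  obtain ⟨P, hP, hPS⟩ := exists_dual (F := F) (L := L)
  have p1 := hP (A * S)
  have p2 := hP A
  have p3 := Submodule.finrank_mono (hPS A S)
  have p4 := Submodule.finrank_le A
  have hPX : InXk k S (P (A * S)) :=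
    ⟨inferInstance, by omega, natCast_le_rank_iff_finrank.2 fun _ ↦ by omega⟩
  have hPfrag : IsFragment k S (P (A * S)) := by
    refine ⟨hPX, fun Y hY ↦ le_trans ?_ (hmin Y hY)⟩
    unfold deltaS
    omega
  have := hatom _ hPfrag
  omega

theorem IsAtomk.ne_top {k : ℕ} {S A : Submodule F L} [FiniteDimensional F S] (hk : 1 ≤ k)
    (hS : S ≠ ⊥) (hA : IsAtomk k S A) : A ≠ ⊤ := by
  rintro rfl
  have := hA.1.1.1
  have hLf : FiniteDimensional F L := Module.Finite.equiv (Submodule.topEquiv (R := F) (M := L))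
  have h1 := natCast_le_rank_iff_finrank.1 hA.1.1.2.2 hLf
  have h2 := finrank_le_finrank_mul (X := (⊤ : Submodule F L)) hS
  rw [finrank_top] at h2
  omega

/-- The linear Cauchy-Davenport inequality. -/
theorem add_le_finrank_mul
    (hL : ∀ K : IntermediateField F L, FiniteDimensional F ↥K → K = ⊥ ∨ K = ⊤)
    {X S : Submodule F L} [FiniteDimensional F X] [FiniteDimensional F S]
    (hX : X ≠ ⊥) (hS : S ≠ ⊥) (hXS : X * S ≠ ⊤) :
    finrank F X + finrank F S ≤ finrank F ↥(X * S) + 1 := by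
  have hXpos : 1 ≤ finrank F X := Submodule.one_le_finrank_iff.2 hX
  have hXX : InXk 1 S X := by
    refine ⟨inferInstance, hXpos, natCast_le_rank_iff_finrank.2 fun h ↦ ?_⟩
    exact Submodule.finrank_lt hXS
  obtain ⟨A, hA⟩ := exists_isAtomk hS ⟨X, hXX⟩
  have hfin := hA.1.1.1
  have hApos := hA.1.1.2.1
  have hA0 : A ≠ ⊥ := Submodule.one_le_finrank_iff.1 hApos
  have hAtop : A ≠ ⊤ := hA.ne_top le_rfl hS
  have hA1 : finrank F A = 1 := by
    by_contra h
    obtain ⟨x, hx, y, hy, hx0, hy0, hxy⟩ := exists_ratio_notMem (A := A) (by omega)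
    refine hxy (mem_range_of_smul_eq hL hA0 hAtop
      (hA.smul_eq le_rfl (div_ne_zero hy0 hx0) (Submodule.one_le_finrank_iff.2 ?_)))
    refine (Submodule.ne_bot_iff _).2 ⟨y, ⟨hy, mem_smul_iff.2 ⟨x, hx, ?_⟩⟩, hy0⟩
    exact div_mul_cancel₀ _ hx0
  have h1 := hA.1.2 X hXX
  have h2 := finrank_le_finrank_mul (X := S) hA0
  rw [mul_comm] at h2
  unfold deltaS at h1
  omega

/-- Distinct translates of `A` meet in dimension at most one. -/
def TranslatesMeetInLine (A : Submodule F L) : Prop :=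
  ∀ z : L, z ∉ Set.range (algebraMap F L) → finrank F ↥(A ⊓ z • A) ≤ 1

theorem ne_zero_of_notMem_range {z : L} (hz : z ∉ Set.range (algebraMap F L)) : z ≠ 0 := by
  rintro rfl
  exact hz ⟨0, map_zero _⟩

theorem TranslatesMeetInLine.smul {A : Submodule F L} (hA : TranslatesMeetInLine A) {w : L}
    (hw : w ≠ 0) : TranslatesMeetInLine (w • A) := by
  intro z hz
  have : (w • A) ⊓ z • w • A = w • (A ⊓ z • A) := by
    ext x
    simp only [Submodule.mem_inf, mem_smul_iff]
    constructor
    · rintro ⟨⟨a, ha, rfl⟩, b, ⟨c, hc, rfl⟩, h⟩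
      exact ⟨a, ⟨ha, c, hc, mul_left_cancel₀ hw (by rw [← h]; ring)⟩, rfl⟩
    · rintro ⟨a, ⟨ha, c, hc, rfl⟩, rfl⟩
      exact ⟨⟨_, ha, rfl⟩, w * c, ⟨c, hc, rfl⟩, by ring⟩
  rw [this, finrank_smul_eq _ hw]
  exact hA z hz

theorem TranslatesMeetInLine.finrank_sup {A : Submodule F L} [FiniteDimensional F A]
    (hA : TranslatesMeetInLine A) {x y : L} (hx : x ≠ 0)
    (hxy : y / x ∉ Set.range (algebraMap F L)) :
    2 * finrank F A ≤ finrank F ↥(x • A ⊔ y • A) + 1 := by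
  have h1 := Submodule.finrank_sup_add_finrank_inf_eq A ((y / x) • A)
  rw [finrank_smul_eq A (ne_zero_of_notMem_range hxy)] at h1
  have h2 := hA _ hxy
  have h3 : x • A ⊔ y • A = x • (A ⊔ (y / x) • A) := by
    rw [Submodule.smul_sup', smul_smul, mul_div_cancel₀ _ hx]
  rw [h3, finrank_smul_eq _ hx]
  omega

theorem TranslatesMeetInLine.le_finrank_mul {A B : Submodule F L} [FiniteDimensional F A]
    [FiniteDimensional F B] (hA : TranslatesMeetInLine A) (hB : 2 ≤ finrank F B) :
    2 * finrank F A ≤ finrank F ↥(B * A) + 1 := by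
  obtain ⟨x, hx, y, hy, hx0, hy0, hxy⟩ := exists_ratio_notMem hB
  exact (hA.finrank_sup hx0 hxy).trans (Nat.add_le_add_right
    (Submodule.finrank_mono (sup_le (smul_le_mul hx) (smul_le_mul hy))) 1)

theorem IsAtomk.translatesMeetInLine
    (hL : ∀ K : IntermediateField F L, FiniteDimensional F ↥K → K = ⊥ ∨ K = ⊤)
    {S A : Submodule F L} [FiniteDimensional F S] (hS : S ≠ ⊥) (hA : IsAtomk 2 S A) :
    TranslatesMeetInLine A := by
  intro z hz
  by_contra! h
  have := hA.1.1.1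
  have h2 := hA.1.1.2.1
  exact hz (mem_range_of_smul_eq hL (Submodule.one_le_finrank_iff.1 (by omega))
    (hA.ne_top (by norm_num) hS)
    (hA.smul_eq (by norm_num) (ne_zero_of_notMem_range hz) h))

/-- Two subspaces of equal dimension with a small product coincide once they share a line
`⟨1, p⟩`, provided their translates are in general position. -/
theorem eq_of_mem_of_finrank_mul
    (hL : ∀ K : IntermediateField F L, FiniteDimensional F ↥K → K = ⊥ ∨ K = ⊤)
    {A B : Submodule F L} [FiniteDimensional F A] [FiniteDimensional F B]
    (hA : TranslatesMeetInLine A) (hB : TranslatesMeetInLine B)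
    (hAB : finrank F A = finrank F B) {p : L} (hp : p ∉ Set.range (algebraMap F L))
    (h1A : 1 ∈ A) (h1B : 1 ∈ B) (hpA : p ∈ A) (hpB : p ∈ B)
    (hmul : finrank F ↥(A * B) + 1 = 2 * finrank F A)
    (hrank : FiniteDimensional F L → finrank F ↥(A * B) + 2 ≤ finrank F L) : A = B := by
  have hp0 := ne_zero_of_notMem_range hp
  by_contra hne
  have hlt : finrank F ↥(A ⊓ B) < finrank F A := by
    refine lt_of_le_of_ne (Submodule.finrank_mono inf_le_left) fun h ↦ hne ?_
    have h1 : A ⊓ B = A := Submodule.eq_of_le_of_finrank_eq inf_le_left h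
    exact Submodule.eq_of_le_of_finrank_eq (inf_eq_left.1 h1) hAB
  have hApos : 1 ≤ finrank F A := by omega
  have hle : p • (A ⊔ B) ≤ (A * B) ⊓ p • (A * B) := by
    refine le_inf ?_ ?_
    · rw [Submodule.smul_sup']
      exact sup_le (mul_comm A B ▸ smul_le_mul hpB) (smul_le_mul hpA)
    · rw [Submodule.smul_sup']
      refine sup_le ?_ ?_ <;> refine Submodule.map_mono ?_
      · intro a ha
        simpa using Submodule.mul_mem_mul ha h1B
      · intro b hb
        simpa using Submodule.mul_mem_mul h1A hb
  have e1 := Submodule.finrank_mono hle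
  rw [finrank_smul_eq _ hp0] at e1
  have e2 := Submodule.finrank_sup_add_finrank_inf_eq (A * B) (p • (A * B))
  rw [finrank_smul_eq _ hp0] at e2
  have e3 := Submodule.finrank_sup_add_finrank_inf_eq A B
  have e4 := hB.finrank_sup (x := 1) (y := p) one_ne_zero (by simpa using hp)
  rw [one_smul] at e4
  have e5 : A * (B ⊔ p • B) = A * B ⊔ p • (A * B) := by
    rw [Submodule.mul_sup, mul_smul_comm]
  have e6 : A * (B ⊔ p • B) = ⊤ := by
    by_contra h
    have := add_le_finrank_mul hL (X := A) (S := B ⊔ p • B)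
      (Submodule.one_le_finrank_iff.1 hApos) (Submodule.one_le_finrank_iff.1 (by omega)) h
    rw [e5] at this
    omega
  have hfin : FiniteDimensional F L := by
    have : FiniteDimensional F (⊤ : Submodule F L) := e6 ▸ inferInstance
    exact Module.Finite.equiv (Submodule.topEquiv (R := F) (M := L))
  have hrank := hrank hfin
  rw [← e5, e6, finrank_top] at e2
  obtain ⟨P, hP, hPS⟩ := exists_dual (F := F) (L := L)
  have p1 := hP (B * A)
  rw [mul_comm B A] at p1
  have p2 := hP B
  have p3 := Submodule.finrank_mono (hPS B A)
  rw [mul_comm B A] at p3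
  have p4 := hA.le_finrank_mul (B := P (A * B)) (by omega)
  omega

theorem exists_mul_self_le_of_translatesMeetInLine
    (hL : ∀ K : IntermediateField F L, FiniteDimensional F ↥K → K = ⊥ ∨ K = ⊤)
    {A B : Submodule F L} [FiniteDimensional F A] [FiniteDimensional F B]
    (hA : TranslatesMeetInLine A) (hB : TranslatesMeetInLine B)
    (hA2 : 2 ≤ finrank F A) (hAB : finrank F A = finrank F B)
    (hmul : finrank F ↥(A * B) + 1 = 2 * finrank F A)
    (hrank : FiniteDimensional F L → finrank F ↥(A * B) + 2 ≤ finrank F L) :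
    ∃ x y : L, x ∈ A ∧ y ∈ A ∧ x ≠ 0 ∧ y ≠ 0 ∧ A * A ≤ x • A ⊔ y • A := by
  obtain ⟨x, hx, y, hy, hx0, hy0, hxy⟩ := exists_ratio_notMem (A := B) (by omega)
  have hpos : 1 ≤ finrank F ↥(x • A ⊓ y • A) := by
    have h1 := Submodule.finrank_sup_add_finrank_inf_eq (x • A) (y • A)
    rw [finrank_smul_eq _ hx0, finrank_smul_eq _ hy0] at h1
    have h2 := Submodule.finrank_mono
      (sup_le (smul_le_mul hx) (smul_le_mul hy) : x • A ⊔ y • A ≤ B * A)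
    rw [mul_comm B A] at h2
    omega
  obtain ⟨w, ⟨hw1, hw2⟩, hw0⟩ :=
    (Submodule.ne_bot_iff _).1 (Submodule.one_le_finrank_iff.1 hpos)
  obtain ⟨a, ha, rfl⟩ := mem_smul_iff.1 hw1
  obtain ⟨b, hb, hab⟩ := mem_smul_iff.1 hw2
  have ha0 : a ≠ 0 := right_ne_zero_of_mul hw0
  have hb0 : b ≠ 0 := by
    rintro rfl
    exact hw0 (by rw [← hab, mul_zero])
  have hratio : a / b = y / x := by
    rw [div_eq_div_iff hb0 hx0]
    linear_combination -hab
  have hbi := inv_ne_zero hb0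
  have hxi := inv_ne_zero hx0
  have hprod : (b⁻¹ • A) * (x⁻¹ • B) = (b⁻¹ * x⁻¹) • (A * B) := by
    rw [smul_mul_assoc, mul_smul_comm, smul_smul]
  have hprodrank : finrank F ↥((b⁻¹ • A) * (x⁻¹ • B)) = finrank F ↥(A * B) := by
    rw [hprod, finrank_smul_eq _ (mul_ne_zero hbi hxi)]
  have heq : b⁻¹ • A = x⁻¹ • B := by
    refine eq_of_mem_of_finrank_mul hL (hA.smul hbi) (hB.smul hxi) ?_ hxy ?_ ?_ ?_ ?_ ?_ ?_
    · rw [finrank_smul_eq _ hbi, finrank_smul_eq _ hxi, hAB]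
    · exact mem_smul_iff.2 ⟨b, hb, inv_mul_cancel₀ hb0⟩
    · exact mem_smul_iff.2 ⟨x, hx, inv_mul_cancel₀ hx0⟩
    · exact mem_smul_iff.2 ⟨a, ha, by rw [← hratio, div_eq_inv_mul]⟩
    · exact mem_smul_iff.2 ⟨y, hy, by rw [div_eq_inv_mul]⟩
    · rw [hprodrank, finrank_smul_eq _ hbi, hmul]
    · rw [hprodrank]
      exact hrank
  have hself : finrank F ↥(A * A) = finrank F ↥(A * B) := by
    rw [← hprodrank, ← heq, smul_mul_assoc, mul_smul_comm, finrank_smul_eq _ hbi,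
      finrank_smul_eq _ hbi]
  refine ⟨b, a, hb, ha, hb0, ha0, le_of_eq (Submodule.eq_of_le_of_finrank_le
    (sup_le (smul_le_mul hb) (smul_le_mul ha)) ?_).symm⟩
  have := hA.finrank_sup hb0 (y := a) (by rwa [hratio])
  omega

theorem finrank_pow_succ_le {A : Submodule F L} [FiniteDimensional F A] {x y : L}
    (hx : x ∈ A) (hy : y ∈ A) (hx0 : x ≠ 0) (hy0 : y ≠ 0) (h : A * A ≤ x • A ⊔ y • A) (t : ℕ) :
    finrank F ↥(A ^ (t + 1)) + 1 ≤ finrank F ↥(A ^ t) + finrank F A := by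
  induction t with
  | zero =>
    have : finrank F (1 : Submodule F L) = 1 := by
      rw [Submodule.one_eq_span]
      exact finrank_span_singleton one_ne_zero
    rw [zero_add, pow_one, pow_zero, this, add_comm]
  | succ t ih =>
    have h1 : A ^ (t + 2) ≤ x • A ^ (t + 1) ⊔ y • A ^ (t + 1) := by
      calc A ^ (t + 2) = A * A * A ^ t := by ring
        _ ≤ (x • A ⊔ y • A) * A ^ t := mul_le_mul_left h _
        _ = x • A ^ (t + 1) ⊔ y • A ^ (t + 1) := by
          rw [Submodule.sup_mul, smul_mul_assoc, smul_mul_assoc, ← pow_succ']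
    have h2 : (x * y) • A ^ t ≤ x • A ^ (t + 1) ⊓ y • A ^ (t + 1) := by
      refine le_inf ?_ ?_
      · rw [mul_smul, pow_succ']
        exact Submodule.map_mono (smul_le_mul hy)
      · rw [mul_comm, mul_smul, pow_succ']
        exact Submodule.map_mono (smul_le_mul hx)
    have e1 := Submodule.finrank_mono h1
    have e2 := Submodule.finrank_mono h2
    have e3 := Submodule.finrank_sup_add_finrank_inf_eq (x • A ^ (t + 1)) (y • A ^ (t + 1))
    rw [finrank_smul_eq _ hx0, finrank_smul_eq _ hy0] at e3
    rw [finrank_smul_eq _ (mul_ne_zero hx0 hy0)] at e2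
    rw [show t + 1 + 1 = t + 2 from rfl]
    omega

/-- A `2`-atom of a one-dimensional space is spanned by two elements. -/
theorem IsAtomk.exists_mul_self_le_of_finrank_eq_one {S A : Submodule F L}
    [FiniteDimensional F S] (hS : finrank F S = 1) (hA : IsAtomk 2 S A)
    (hδ : deltaS S A = 0) :
    ∃ x y : L, x ∈ A ∧ y ∈ A ∧ x ≠ 0 ∧ y ≠ 0 ∧ A * A ≤ x • A ⊔ y • A := by
  have hfin := hA.1.1.1
  obtain ⟨x, hx, y, hy, hx0, hy0, hxy⟩ := exists_ratio_notMem (A := A) hA.1.1.2.1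
  obtain ⟨w, hw0, hw⟩ := finrank_eq_one_iff'.1 hS
  have hw0 : (w : L) ≠ 0 := fun h ↦ hw0 (Subtype.ext h)
  have hSw : S = span F {(w : L)} := by
    refine le_antisymm (fun s hs ↦ ?_) ((span_singleton_le_iff_mem _ _).2 w.2)
    obtain ⟨c, hc⟩ := hw ⟨s, hs⟩
    exact mem_span_singleton.2 ⟨c, congrArg Subtype.val hc⟩
  have hle : span F {x, y} ≤ A := span_le.2 (by
    rintro _ (rfl | rfl)
    exacts [hx, hy])
  have : FiniteDimensional F (span F {x, y}) := Submodule.finiteDimensional_of_le hle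
  have hdim2 : finrank F (span F {x, y}) = 2 := by
    have hli : LinearIndependent F ![x, y] := by
      rw [LinearIndependent.pair_iff' hx0]
      rintro c rfl
      exact hxy ⟨c, by rw [Algebra.smul_def, mul_div_cancel_right₀ _ hx0]⟩
    have := finrank_span_eq_card hli
    rwa [Matrix.range_cons_cons_empty, Fintype.card_fin] at this
  have hdim : ∀ X : Submodule F L, finrank F ↥(X * S) = finrank F X := fun X ↦ by
    rw [mul_comm, hSw, Submodule.span_singleton_mul, finrank_smul_eq _ hw0]
  have hX : InXk 2 S (span F {x, y}) := by
    refine ⟨inferInstance, hdim2.ge, natCast_le_rank_iff_finrank.2 fun h ↦ ?_⟩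
    have h1 := natCast_le_rank_iff_finrank.1 hA.1.1.2.2 h
    have h2 := Submodule.finrank_mono hle
    rw [hdim] at h1 ⊢
    omega
  have hfrag : IsFragment 2 S (span F {x, y}) := by
    refine ⟨hX, fun Y hY ↦ le_trans ?_ (hA.1.2 Y hY)⟩
    rw [hδ, deltaS, hdim, sub_self]
  have heq : span F {x, y} = A := Submodule.eq_of_le_of_finrank_le hle (hA.2 _ hfrag)
  refine ⟨x, y, hx, hy, hx0, hy0, le_of_eq ?_⟩
  calc A * A = (span F {x} ⊔ span F {y}) * A := by rw [← span_insert, heq]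
    _ = x • A ⊔ y • A := by
      rw [Submodule.sup_mul, Submodule.span_singleton_mul, Submodule.span_singleton_mul]

theorem IsAtomk.exists_mul_self_le
    (hL : ∀ K : IntermediateField F L, FiniteDimensional F ↥K → K = ⊥ ∨ K = ⊤)
    {S A : Submodule F L} [FiniteDimensional F S] (hA : IsAtomk 2 S A)
    (hδ : deltaS S A = (finrank F S : ℤ) - 1) :
    ∃ x y : L, x ∈ A ∧ y ∈ A ∧ x ≠ 0 ∧ y ≠ 0 ∧ A * A ≤ x • A ⊔ y • A := by
  have hfin := hA.1.1.1
  have hA2 := hA.1.1.2.1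
  have hrank := natCast_le_rank_iff_finrank.1 hA.1.1.2.2
  have hA0 : A ≠ ⊥ := Submodule.one_le_finrank_iff.1 (by omega)
  have hdim : finrank F ↥(A * S) + 1 = finrank F A + finrank F S := by
    unfold deltaS at hδ
    omega
  have hSpos : 1 ≤ finrank F S := by
    by_contra h
    have h0 : S = ⊥ := Submodule.finrank_eq_zero.1 (by omega)
    rw [h0, Submodule.mul_bot, finrank_bot] at hdim
    omega
  rcases hSpos.eq_or_lt with hS1 | hS2
  · exact hA.exists_mul_self_le_of_finrank_eq_one hS1.symm (by omega)
  have hS0 : S ≠ ⊥ := Submodule.one_le_finrank_iff.1 hSpos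
  have hAline := hA.translatesMeetInLine hL hS0
  have hSX : InXk 2 A S := ⟨inferInstance, hS2, by rw [mul_comm]; exact hA.1.1.2.2⟩
  obtain ⟨B, hB⟩ := exists_isAtomk hA0 ⟨S, hSX⟩
  have hBfin := hB.1.1.1
  have hB2 := hB.1.1.2.1
  have hBrank := natCast_le_rank_iff_finrank.1 hB.1.1.2.2
  have hBline := hB.translatesMeetInLine hL hA0
  have h1 := hB.1.2 S hSX
  unfold deltaS at h1
  rw [mul_comm S A] at h1
  have h2 := hAline.le_finrank_mul hB2
  have h3 := hBline.le_finrank_mul hA2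
  rw [mul_comm B A] at h1 h2 hBrank
  exact exists_mul_self_le_of_translatesMeetInLine hL hAline hBline hA2 (by omega) (by omega) hBrank

end Helpers

theorem stmt9
    (hsep : ¬ FiniteDimensional F L ∨ (FiniteDimensional F L ∧ Algebra.IsSeparable F L))
    (hL : ∀ K : IntermediateField F L, FiniteDimensional F ↥K → K = ⊥ ∨ K = ⊤)
    (S : Submodule F L) (hS : FiniteDimensional F ↥S)
    (hκmin : ∀ X : Submodule F L, InXk 2 S X → (finrank F ↥S : ℤ) - 1 ≤ deltaS S X)
    (hκex : ∃ X : Submodule F L, InXk 2 S X ∧ deltaS S X = (finrank F ↥S : ℤ) - 1)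
    (A : Submodule F L) (hA : IsAtomk 2 S A)
    (t : ℕ) (ht : 2 ≤ t) :
    (finrank F ↥(A ^ t) : Cardinal) =
      min ((finrank F ↥(A ^ (t - 1)) + finrank F ↥A - 1 : ℕ) : Cardinal)
        (Module.rank F L) := by
  obtain ⟨X, hX, hXδ⟩ := hκex
  have hδ : deltaS S A = (finrank F S : ℤ) - 1 :=
    le_antisymm ((hA.1.2 X hX).trans hXδ.le) (hκmin A hA.1.1)
  have hfin := hA.1.1.1
  have hA2 := hA.1.1.2.1
  obtain ⟨x, y, hx, hy, hx0, hy0, hsq⟩ := hA.exists_mul_self_le hL hδ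
  obtain ⟨t, rfl⟩ : ∃ n, t = n + 1 := ⟨t - 1, by omega⟩
  rw [Nat.add_sub_cancel]
  have hle := finrank_pow_succ_le hx hy hx0 hy0 hsq t
  have hA0 : A ≠ ⊥ := Submodule.one_le_finrank_iff.1 (by omega)
  have hpow0 : A ^ t ≠ ⊥ :=
    (Submodule.ne_bot_iff _).2 ⟨x ^ t, Submodule.pow_mem_pow A hx t, pow_ne_zero t hx0⟩
  refine le_antisymm (le_min (Nat.cast_le.2 (by omega)) ?_) ?_
  · rw [finrank_eq_rank]
    exact Submodule.rank_le _
  · by_cases htop : A ^ (t + 1) = ⊤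
    · refine (min_le_right _ _).trans (le_of_eq ?_)
      rw [finrank_eq_rank, htop, rank_top]
    · refine (min_le_left _ _).trans (Nat.cast_le.2 ?_)
      rw [pow_succ] at htop ⊢
      have := add_le_finrank_mul hL hpow0 hA0 htop
      omega
end

section
/- Let L/F be a finite separable extension with no proper intermediate extension, and suppose [L:F] − 2 is prime. Let S, T be F-subspaces of L with dim(S), dim(T) ≥ 2 and dim(ST) ≤ [L:F] − 2. If dim(ST) = dim(S) + dim(T) − 1, then there exist g, g′, a ∈ L such that {g, ga, …, g a^{dim S − 1}} is a basis of S and {g′, g′a, …, g′ a^{dim T − 1}} is a basis of T. -/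
open Module Submodule

namespace LinVosper

variable {F L : Type*} [Field F] [Field L] [Algebra F L]

theorem finrank_span_singleton_mul {g : L} (hg : g ≠ 0) (X : Submodule F L) :
    finrank F ↥(span F {g} * X) = finrank F X := by
  have h : span F {g} * X = X.map (LinearMap.mulLeft F g) := by
    ext x
    simp [Submodule.mem_span_singleton_mul]
  rw [h]
  exact (LinearEquiv.finrank_eq (X.equivMapOfInjective _ (mul_right_injective₀ hg))).symm

theorem inv_singleton_mul {g : L} (hg : g ≠ 0) (X : Submodule F L) :
    span F {g⁻¹} * (span F {g} * X) = X := by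
  rw [← mul_assoc, span_mul_span, Set.singleton_mul_singleton, inv_mul_cancel₀ hg,
    ← one_eq_span, one_mul]

/-- The orthogonal complement for the trace form. -/
noncomputable def traceOrthogonal (V : Submodule F L) : Submodule F L :=
  (Algebra.traceForm F L).orthogonal V

theorem mul_traceOrthogonal_le (X Y : Submodule F L) :
    X * traceOrthogonal (X * Y) ≤ traceOrthogonal Y := by
  rw [mul_le]
  intro x hx z hz y hy
  have h : Algebra.trace F L (x * y * z) = 0 := hz (x * y) (mul_mem_mul hx hy)
  change Algebra.trace F L (y * (x * z)) = 0
  rw [← h]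
  congr 1
  ring

theorem exists_mul_inv_notMem_bot {A : Submodule F L} (hA : 2 ≤ finrank F A) :
    ∃ x ∈ A, ∃ y ∈ A, x ≠ 0 ∧ y ≠ 0 ∧ y * x⁻¹ ∉ (⊥ : IntermediateField F L) := by
  have hA0 : A ≠ ⊥ := by
    rintro rfl
    simp at hA
  obtain ⟨x, hx, hx0⟩ := A.exists_mem_ne_zero_of_ne_bot hA0
  have h : ¬ A ≤ span F {x} := fun h => by
    have := finrank_mono h
    rw [finrank_span_singleton hx0] at this
    omega
  obtain ⟨y, hy, hyx⟩ := SetLike.not_le_iff_exists.1 h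
  refine ⟨x, hx, y, hy, hx0, ?_, ?_⟩
  · rintro rfl
    exact hyx (zero_mem _)
  · rintro ⟨c, hc⟩
    refine hyx (mem_span_singleton.2 ⟨c, ?_⟩)
    rw [Algebra.smul_def]
    exact (eq_mul_inv_iff_mul_eq₀ hx0).1 hc

theorem ne_bot_of_finrank_pos {X : Submodule F L} (h : 0 < finrank F X) : X ≠ ⊥ := by
  rintro rfl
  simp at h

theorem ne_top_of_finrank_lt {X : Submodule F L} (h : finrank F X < finrank F L) : X ≠ ⊤ := by
  rintro rfl
  simp at h

theorem span_pair_mul (g : L) (X : Submodule F L) :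
    span F {1, g} * X = X ⊔ span F {g} * X := by
  rw [span_insert, Submodule.sup_mul, ← one_eq_span, one_mul]

theorem span_pair_pow_le (g : L) (k : ℕ) :
    span F {1, g} ^ k ≤ span F (Set.range fun i : Fin (k + 1) => g ^ (i : ℕ)) := by
  induction k with
  | zero =>
    rw [pow_zero, one_eq_span]
    exact span_mono (by rintro _ rfl; exact ⟨0, by simp⟩)
  | succ k ih =>
    rw [pow_succ']
    refine (mul_le_mul' le_rfl ih).trans ?_
    rw [span_mul_span, span_le]
    rintro _ ⟨x, hx, _, ⟨i, rfl⟩, rfl⟩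
    apply subset_span
    rcases hx with rfl | rfl
    · exact ⟨i.castSucc, by simp⟩
    · exact ⟨i.succ, by simp [pow_succ']⟩

theorem sup_singleton_mul_le {A S : Submodule F L} {f g : L} (hf : f ∈ A) (hg : g ∈ A) :
    span F {f} * S ⊔ span F {g} * S ≤ A * S :=
  sup_le (mul_le_mul' ((span_singleton_le_iff_mem f A).2 hf) le_rfl)
    (mul_le_mul' ((span_singleton_le_iff_mem g A).2 hg) le_rfl)

/-- `S` and `T` attain equality in the linear Cauchy–Davenport theorem, away from the
degenerate cases. -/
structure CriticalPair (S T : Submodule F L) : Prop where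
  two_le_left : 2 ≤ finrank F S
  two_le_right : 2 ≤ finrank F T
  finrank_mul : finrank F ↥(S * T) + 1 = finrank F S + finrank F T
  finrank_mul_le : finrank F ↥(S * T) + 2 ≤ finrank F L

namespace CriticalPair

variable {A S T : Submodule F L}

theorem symm (h : CriticalPair S T) : CriticalPair T S where
  two_le_left := h.two_le_right
  two_le_right := h.two_le_left
  finrank_mul := by
    rw [mul_comm, h.finrank_mul, add_comm]
  finrank_mul_le := by
    rw [mul_comm]
    exact h.finrank_mul_le

theorem singleton_mul (h : CriticalPair A S) {g : L} (hg : g ≠ 0) :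
    CriticalPair A (span F {g} * S) := by
  have h1 : finrank F ↥(A * (span F {g} * S)) = finrank F ↥(A * S) := by
    rw [mul_left_comm, finrank_span_singleton_mul hg]
  have h2 := finrank_span_singleton_mul hg S
  have := h.two_le_left
  have := h.two_le_right
  have := h.finrank_mul
  have := h.finrank_mul_le
  constructor <;> omega

theorem ne_bot_right (h : CriticalPair A S) : S ≠ ⊥ :=
  ne_bot_of_finrank_pos (by have := h.two_le_right; omega)

theorem ne_top_right (h : CriticalPair A S) : S ≠ ⊤ := by
  obtain ⟨h1, h2, h3, h4⟩ := h
  exact ne_top_of_finrank_lt (by omega)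

end CriticalPair

/-- `X` has a basis `w, w g, …, w g ^ k`. -/
def IsGeometric (g : L) (X : Submodule F L) : Prop :=
  ∃ w : L, w ≠ 0 ∧ ∃ k : ℕ, finrank F X = k + 1 ∧ X = span F {w} * span F {1, g} ^ k

theorem IsGeometric.exists_basis {g : L} {X : Submodule F L} (hX : IsGeometric g X) :
    ∃ w : L, ∃ b : Basis (Fin (finrank F X)) F X, ∀ i, (b i : L) = w * g ^ (i : ℕ) := by
  obtain ⟨w, -, k, hk, hXw⟩ := hX
  rw [hk]
  have hle : X ≤ span F (Set.range fun i : Fin (k + 1) => w * g ^ (i : ℕ)) := by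
    rw [hXw]
    refine (mul_le_mul' le_rfl (span_pair_pow_le g k)).trans ?_
    rw [span_mul_span, Set.singleton_mul, ← Set.range_comp]
    rfl
  have hmem : ∀ i : Fin (k + 1), w * g ^ (i : ℕ) ∈ X := by
    intro i
    rw [hXw]
    refine mul_mem_mul (mem_span_singleton_self w) ?_
    have h1 : (1 : Submodule F L) ≤ span F {1, g} := by
      rw [one_eq_span]
      exact span_mono (by simp)
    exact pow_le_pow_right' h1 i.is_le (pow_mem_pow _ (subset_span (by simp)) _)
  let v : Fin (k + 1) → X := fun i => ⟨w * g ^ (i : ℕ), hmem i⟩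
  have hv : ⊤ ≤ span F (Set.range v) := by
    rw [← map_le_map_iff_of_injective X.injective_subtype, map_span, ← Set.range_comp,
      Submodule.map_top, range_subtype]
    exact hle
  refine ⟨w, basisOfTopLeSpanOfCardEqFinrank v hv (by rw [hk, Fintype.card_fin]), fun i => ?_⟩
  rw [coe_basisOfTopLeSpanOfCardEqFinrank]

variable [FiniteDimensional F L]

/-- Over an extension without proper intermediate fields, only scalars stabilise a
proper nonzero subspace. -/
theorem mem_bot_of_singleton_mul_le
    (hL : ∀ K : IntermediateField F L, K = ⊥ ∨ K = ⊤) {V : Submodule F L} (h0 : V ≠ ⊥)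
    (h1 : V ≠ ⊤) {g : L} (hg : span F {g} * V ≤ V) : g ∈ (⊥ : IntermediateField F L) := by
  rcases hL (IntermediateField.adjoin F {g}) with h | h
  · rw [← h]
    exact IntermediateField.mem_adjoin_simple_self F g
  · exfalso
    apply h1
    have key : ∀ x : L, ∀ v ∈ V, x * v ∈ V := by
      intro x
      have hx : x ∈ Algebra.adjoin F {g} := by
        rw [← IntermediateField.adjoin_simple_toSubalgebra_of_isAlgebraic
          (Algebra.IsAlgebraic.isAlgebraic g), h]
        trivial
      induction hx using Algebra.adjoin_induction with
      | mem y hy =>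
        intro v hv
        rw [Set.mem_singleton_iff.1 hy]
        exact hg (mul_mem_mul (mem_span_singleton_self g) hv)
      | algebraMap r =>
        intro v hv
        rw [← Algebra.smul_def]
        exact V.smul_mem r hv
      | add y z _ _ hy hz =>
        intro v hv
        rw [add_mul]
        exact V.add_mem (hy v hv) (hz v hv)
      | mul y z _ _ hy hz =>
        intro v hv
        rw [mul_assoc]
        exact hy _ (hz v hv)
    obtain ⟨v, hv, hv0⟩ := V.exists_mem_ne_zero_of_ne_bot h0
    rw [eq_top_iff]
    intro w _
    have := key (w * v⁻¹) v hv
    rwa [inv_mul_cancel_right₀ hv0] at this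

theorem finrank_sup_mul_add_finrank_inf_mul_le (A B S : Submodule F L) :
    finrank F ↥((A ⊔ B) * S) + finrank F ↥((A ⊓ B) * S) ≤
      finrank F ↥(A * S) + finrank F ↥(B * S) := by
  rw [Submodule.sup_mul, ← finrank_sup_add_finrank_inf_eq (A * S)]
  gcongr
  exact finrank_mono (le_inf (mul_le_mul' inf_le_left le_rfl) (mul_le_mul' inf_le_right le_rfl))

theorem finrank_le_finrank_mul (X : Submodule F L) {S : Submodule F L} (hS : S ≠ ⊥) :
    finrank F X ≤ finrank F ↥(X * S) := by
  obtain ⟨s, hs, hs0⟩ := S.exists_mem_ne_zero_of_ne_bot hS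
  rw [← finrank_span_singleton_mul hs0, mul_comm]
  exact finrank_mono (mul_le_mul_right ((span_singleton_le_iff_mem s S).2 hs) X)

theorem finrank_traceOrthogonal [Algebra.IsSeparable F L] (V : Submodule F L) :
    finrank F V + finrank F (traceOrthogonal V) = finrank F L := by
  have h := LinearMap.BilinForm.finrank_orthogonal (traceForm_nondegenerate F L) V
  have := V.finrank_le
  rw [traceOrthogonal]
  omega


theorem finrank_pos_of_ne_bot {X : Submodule F L} (h : X ≠ ⊥) : 0 < finrank F X :=
  Nat.pos_of_ne_zero fun h0 => h (finrank_eq_zero.1 h0)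

/-- A non-scalar multiple of a proper nonzero subspace meets it in a smaller subspace. -/
theorem finrank_inf_singleton_mul_lt
    (hL : ∀ K : IntermediateField F L, K = ⊥ ∨ K = ⊤) {V : Submodule F L} (h0 : V ≠ ⊥)
    (h1 : V ≠ ⊤) {g : L} (hg : g ∉ (⊥ : IntermediateField F L)) :
    finrank F ↥(V ⊓ span F {g} * V) < finrank F V := by
  have hg0 : g ≠ 0 := by
    rintro rfl
    exact hg (zero_mem _)
  by_contra! h
  have hI : V ⊓ span F {g} * V = span F {g} * V :=
    eq_of_le_of_finrank_le inf_le_right (by rwa [finrank_span_singleton_mul hg0])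
  exact hg (mem_bot_of_singleton_mul_le hL h0 h1 (inf_eq_right.1 hI))

/-- The linear Cauchy–Davenport theorem. -/
theorem finrank_add_finrank_le_finrank_mul_add_one [Algebra.IsSeparable F L]
    (hL : ∀ K : IntermediateField F L, K = ⊥ ∨ K = ⊤) {X S : Submodule F L}
    (hX : X ≠ ⊥) (hS : S ≠ ⊥) (hXS : X * S ≠ ⊤) :
    finrank F X + finrank F S ≤ finrank F ↥(X * S) + 1 := by
  let P : Submodule F L → Prop := fun Y => Y ≠ ⊥ ∧ Y * S ≠ ⊤
  obtain ⟨Y, hY, hYmin⟩ := exists_minimalFor_of_wellFoundedLT P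
    (fun Y => finrank F ↥(Y * S) - finrank F Y) ⟨X, hX, hXS⟩
  obtain ⟨k, hk⟩ := Nat.exists_eq_add_of_le (finrank_le_finrank_mul Y hS)
  have hmin : ∀ Z, P Z → finrank F Z + k ≤ finrank F ↥(Z * S) := by
    intro Z hZ
    have h1 := finrank_le_finrank_mul Z hS
    rcases le_total (finrank F ↥(Z * S) - finrank F Z) (finrank F ↥(Y * S) - finrank F Y)
      with h | h
    · have := hYmin hZ h
      dsimp only at this
      omega
    · omega
  obtain ⟨A, ⟨⟨hA0, hAS⟩, hAk⟩, hAmin⟩ := exists_minimalFor_of_wellFoundedLT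
    (fun Y => P Y ∧ finrank F ↥(Y * S) = finrank F Y + k) (fun Y => finrank F Y) ⟨Y, hY, hk⟩
  have hatom : ∀ Z, P Z → finrank F ↥(Z * S) ≤ finrank F Z + k → finrank F A ≤ finrank F Z := by
    intro Z hZ h
    rcases le_total (finrank F A) (finrank F Z) with h' | h'
    · exact h'
    · exact hAmin ⟨hZ, le_antisymm h (hmin Z hZ)⟩ h'
  have hASlt := finrank_lt hAS
  have hA1 := finrank_pos_of_ne_bot hA0
  have hdual : 2 * finrank F A + k ≤ finrank F L := by
    have h1 := finrank_traceOrthogonal (A * S)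
    have h2 := finrank_traceOrthogonal A
    have h3 : finrank F ↥(traceOrthogonal (A * S) * S) ≤ finrank F (traceOrthogonal A) := by
      rw [mul_comm, mul_comm A S]
      exact finrank_mono (mul_traceOrthogonal_le S A)
    have := hatom (traceOrthogonal (A * S))
      ⟨ne_bot_of_finrank_pos (by omega), ne_top_of_finrank_lt (by omega)⟩ (by omega)
    omega
  have hAle : finrank F A ≤ 1 := by
    by_contra! hA2
    obtain ⟨x, hx, y, hy, hx0, hy0, hxy⟩ := exists_mul_inv_notMem_bot hA2
    have hg0 : y * x⁻¹ ≠ 0 := mul_ne_zero hy0 (inv_ne_zero hx0)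
    have hI := finrank_inf_singleton_mul_lt hL hA0 (ne_top_of_finrank_lt (by omega)) hxy
    set B := span F {y * x⁻¹} * A with hB
    have hdB : finrank F B = finrank F A := finrank_span_singleton_mul hg0 A
    have hdBS : finrank F ↥(B * S) = finrank F ↥(A * S) := by
      rw [hB, mul_assoc, finrank_span_singleton_mul hg0]
    have hyB : y ∈ B := mem_span_singleton_mul.2 ⟨x, hx, inv_mul_cancel_right₀ hx0 y⟩
    have hI0 : A ⊓ B ≠ ⊥ := fun h => hy0 ((mem_bot F).1 (h ▸ ⟨hy, hyB⟩))
    have hIS : finrank F ↥((A ⊓ B) * S) ≤ finrank F ↥(A * S) :=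
      finrank_mono (mul_le_mul' inf_le_left le_rfl)
    have hIS' : finrank F ↥(A ⊓ B) + k < finrank F ↥((A ⊓ B) * S) := by
      by_contra! h
      have := hatom (A ⊓ B) ⟨hI0, ne_top_of_finrank_lt (by omega)⟩ h
      omega
    have h1 := finrank_sup_add_finrank_inf_eq A B
    have h2 := finrank_sup_mul_add_finrank_inf_mul_le A B S
    by_cases hJ : (A ⊔ B) * S = ⊤
    · rw [hJ, finrank_top] at h2
      omega
    · have := hmin (A ⊔ B) ⟨fun h => hA0 (eq_bot_iff.2 (h ▸ le_sup_left)), hJ⟩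
      omega
  have h1 := finrank_le_finrank_mul S hA0
  rw [mul_comm] at h1
  have h2 := hmin X ⟨hX, hXS⟩
  omega

namespace CriticalPair

variable {A S T : Submodule F L}

theorem finrank_inf_singleton_mul_lt (hL : ∀ K : IntermediateField F L, K = ⊥ ∨ K = ⊤)
    (h : CriticalPair A S) {f g : L} (hf0 : f ≠ 0)
    (hgf : g * f⁻¹ ∉ (⊥ : IntermediateField F L)) :
    finrank F ↥(span F {f} * S ⊓ span F {g} * S) < finrank F S := by
  have h1 := LinVosper.finrank_inf_singleton_mul_lt hL (h.singleton_mul hf0).ne_bot_right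
    (h.singleton_mul hf0).ne_top_right hgf
  rwa [finrank_span_singleton_mul hf0, ← mul_assoc, span_mul_span, Set.singleton_mul_singleton,
    inv_mul_cancel_right₀ hf0] at h1

variable [Algebra.IsSeparable F L]

theorem dual (hL : ∀ K : IntermediateField F L, K = ⊥ ∨ K = ⊤) (h : CriticalPair A S) :
    CriticalPair A (traceOrthogonal (A * S)) := by
  obtain ⟨h1, h2, h3, h4⟩ := h
  have h5 := finrank_traceOrthogonal (A * S)
  have h6 := finrank_traceOrthogonal S
  have h7 := finrank_mono (mul_traceOrthogonal_le A S)
  have h8 := finrank_add_finrank_le_finrank_mul_add_one hL (X := A)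
    (S := traceOrthogonal (A * S)) (ne_bot_of_finrank_pos (by omega))
    (ne_bot_of_finrank_pos (by omega)) (ne_top_of_finrank_lt (by omega))
  constructor <;> omega

theorem inf (hL : ∀ K : IntermediateField F L, K = ⊥ ∨ K = ⊤) (hS : CriticalPair A S)
    (hT : CriticalPair A T) (h2 : 2 ≤ finrank F ↥(S ⊓ T))
    (hn : finrank F ↥(S ⊔ T) + finrank F A ≤ finrank F L + 1) : CriticalPair A (S ⊓ T) := by
  have h1 := finrank_sup_add_finrank_inf_eq S T
  have h3 := finrank_sup_mul_add_finrank_inf_mul_le S T A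
  obtain ⟨hS1, hS2, hS3, hS4⟩ := hS.symm
  obtain ⟨hT1, hT2, hT3, hT4⟩ := hT.symm
  have h4 : finrank F ↥((S ⊓ T) * A) ≤ finrank F ↥(S * A) :=
    finrank_mono (mul_le_mul' inf_le_left le_rfl)
  have h5 := finrank_add_finrank_le_finrank_mul_add_one hL (X := S ⊓ T) (S := A)
    (ne_bot_of_finrank_pos (by omega)) (ne_bot_of_finrank_pos (by omega))
    (ne_top_of_finrank_lt (by omega))
  have h6 : finrank F ↥(S ⊔ T) + finrank F A ≤ finrank F ↥((S ⊔ T) * A) + 1 := by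
    by_cases hJ : (S ⊔ T) * A = ⊤
    · rwa [hJ, finrank_top]
    · exact finrank_add_finrank_le_finrank_mul_add_one hL
        (ne_bot_of_finrank_pos (by omega)) (ne_bot_of_finrank_pos (by omega)) hJ
  exact (CriticalPair.mk (by omega) (by omega) (by omega) (by omega)).symm

theorem finrank_add_two_mul_le (hL : ∀ K : IntermediateField F L, K = ⊥ ∨ K = ⊤)
    (hmin : ∀ X, CriticalPair A X → finrank F A ≤ finrank F X) (h : CriticalPair A S) :
    finrank F S + 2 * finrank F A ≤ finrank F L + 1 := by
  have h1 := hmin _ (h.dual hL)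
  have h2 := finrank_traceOrthogonal (A * S)
  have h3 := h.finrank_mul
  omega

/-- If `A` has minimal dimension, then `f S ∩ g S` is again critical with `A` for `f, g ∈ A`. -/
theorem inf_singleton_mul (hL : ∀ K : IntermediateField F L, K = ⊥ ∨ K = ⊤)
    (hmin : ∀ X, CriticalPair A X → finrank F A ≤ finrank F X) (h : CriticalPair A S)
    (hlt : finrank F A < finrank F S) {f g : L} (hf : f ∈ A) (hg : g ∈ A) (hf0 : f ≠ 0)
    (hg0 : g ≠ 0) : CriticalPair A (span F {f} * S ⊓ span F {g} * S) := by
  have h1 := finrank_sup_add_finrank_inf_eq (span F {f} * S) (span F {g} * S)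
  rw [finrank_span_singleton_mul hf0, finrank_span_singleton_mul hg0] at h1
  have h2 := finrank_mono (sup_singleton_mul_le (S := S) hf hg)
  have h3 := h.finrank_mul
  have h4 := h.finrank_add_two_mul_le hL hmin
  exact (h.singleton_mul hf0).inf hL (h.singleton_mul hg0) (by omega) (by omega)

/-- If `A` has minimal dimension, every `S` critical with `A` contains one of dimension
`dim A`. -/
theorem exists_le_finrank_eq (hL : ∀ K : IntermediateField F L, K = ⊥ ∨ K = ⊤)
    (hmin : ∀ X, CriticalPair A X → finrank F A ≤ finrank F X) (h : CriticalPair A S) :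
    ∃ B ≤ S, CriticalPair A B ∧ finrank F B = finrank F A := by
  obtain ⟨B, ⟨hBS, hB⟩, hBmin⟩ := exists_minimalFor_of_wellFoundedLT
    (fun B => B ≤ S ∧ CriticalPair A B) (fun B => finrank F B) ⟨S, le_rfl, h⟩
  refine ⟨B, hBS, hB, le_antisymm ?_ (hmin B hB)⟩
  by_contra! hlt
  obtain ⟨x, hx, y, hy, hx0, hy0, hxy⟩ := exists_mul_inv_notMem_bot h.two_le_left
  have h1 := (hB.inf_singleton_mul hL hmin hlt hx hy hx0 hy0).singleton_mul (inv_ne_zero hx0)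
  have h2 : span F {x⁻¹} * (span F {x} * B ⊓ span F {y} * B) ≤ B :=
    (mul_le_mul' le_rfl inf_le_left).trans (inv_singleton_mul hx0 B).le
  have h3 := finrank_inf_singleton_mul_lt hL hB hx0 hxy
  have h4 := finrank_span_singleton_mul (inv_ne_zero hx0) (span F {x} * B ⊓ span F {y} * B)
  have h5 := hBmin ⟨h2.trans hBS, h1⟩ (by dsimp only; omega)
  dsimp only at h5
  omega

/-- Some two multiples of `S` by elements of `A` already span `A * S`. -/
theorem exists_finrank_sup (hL : ∀ K : IntermediateField F L, K = ⊥ ∨ K = ⊤)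
    (hmin : ∀ X, CriticalPair A X → finrank F A ≤ finrank F X) (h : CriticalPair A S) :
    ∃ f ∈ A, ∃ g ∈ A, f ≠ 0 ∧ g ≠ 0 ∧
      finrank F S + finrank F A ≤ finrank F ↥(span F {f} * S ⊔ span F {g} * S) + 1 := by
  by_contra! hcon
  obtain ⟨f, hf, g, hg, hf0, hg0, hgf⟩ := exists_mul_inv_notMem_bot h.two_le_left
  obtain ⟨B, hBS, hB, hBA⟩ := h.exists_le_finrank_eq hL hmin
  have hsmall := hcon f hf g hg hf0 hg0
  have hstep : ∀ C ≤ S, CriticalPair A C → finrank F C = finrank F A →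
      span F {g * f⁻¹} * C ≤ S := by
    intro C hCS hC hCA
    have h1 := finrank_sup_add_finrank_inf_eq (span F {f} * S) (span F {g} * C)
    have h2 : finrank F ↥(span F {f} * S ⊔ span F {g} * C) ≤
        finrank F ↥(span F {f} * S ⊔ span F {g} * S) :=
      finrank_mono (sup_le_sup le_rfl (mul_le_mul' le_rfl hCS))
    have h3 := h.finrank_add_two_mul_le hL hmin
    rw [finrank_span_singleton_mul hf0, finrank_span_singleton_mul hg0] at h1
    have h4 := hmin _ ((h.singleton_mul hf0).inf hL (hC.singleton_mul hg0) (by omega) (by omega))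
    have h5 : span F {f} * S ⊓ span F {g} * C = span F {g} * C :=
      eq_of_le_of_finrank_le inf_le_right (by rw [finrank_span_singleton_mul hg0]; omega)
    calc span F {g * f⁻¹} * C = span F {f⁻¹} * (span F {g} * C) := by
          rw [← mul_assoc, span_mul_span, Set.singleton_mul_singleton, mul_comm g]
      _ ≤ span F {f⁻¹} * (span F {f} * S) := mul_le_mul' le_rfl (inf_eq_right.1 h5)
      _ = S := inv_singleton_mul hf0 S
  have hq0 : g * f⁻¹ ≠ 0 := mul_ne_zero hg0 (inv_ne_zero hf0)
  have hpow : ∀ k : ℕ, span F {(g * f⁻¹) ^ k} * B ≤ S := by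
    intro k
    induction k with
    | zero => rwa [pow_zero, ← one_eq_span, one_mul]
    | succ k ih =>
      have := hstep _ ih (hB.singleton_mul (pow_ne_zero k hq0))
        ((finrank_span_singleton_mul (pow_ne_zero k hq0) B).trans hBA)
      rwa [← mul_assoc, span_mul_span, Set.singleton_mul_singleton, ← pow_succ'] at this
  have hle : (⨆ k : ℕ, span F {(g * f⁻¹) ^ k} * B) ≤ S := iSup_le hpow
  refine hgf (mem_bot_of_singleton_mul_le hL (V := ⨆ k : ℕ, span F {(g * f⁻¹) ^ k} * B)
    (fun h0 => hB.ne_bot_right ?_) (fun h1 => h.ne_top_right (top_le_iff.1 (h1 ▸ hle))) ?_)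
  · have := le_iSup (fun k : ℕ => span F {(g * f⁻¹) ^ k} * B) 0
    rw [h0, pow_zero, ← one_eq_span, one_mul] at this
    exact le_bot_iff.1 this
  · rw [Submodule.mul_iSup]
    refine iSup_le fun k => ?_
    rw [← mul_assoc, span_mul_span, Set.singleton_mul_singleton, ← pow_succ']
    exact le_iSup (fun k : ℕ => span F {(g * f⁻¹) ^ k} * B) (k + 1)

theorem finrank_sub_one_dvd (hL : ∀ K : IntermediateField F L, K = ⊥ ∨ K = ⊤)
    (hmin : ∀ X, CriticalPair A X → finrank F A ≤ finrank F X) (h : CriticalPair A S) :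
    finrank F A - 1 ∣ finrank F S - 1 := by
  induction hs : finrank F S using Nat.strong_induction_on generalizing S with
  | _ s ih =>
  have hA2 := h.two_le_left
  rcases (hmin S h).eq_or_lt with heq | hlt
  · rw [← hs, heq]
  obtain ⟨f, hf, g, hg, hf0, hg0, hfg⟩ := h.exists_finrank_sup hL hmin
  have h1 := finrank_sup_add_finrank_inf_eq (span F {f} * S) (span F {g} * S)
  have h2 := finrank_mono (sup_singleton_mul_le (S := S) hf hg)
  have h3 := h.finrank_mul
  rw [finrank_span_singleton_mul hf0, finrank_span_singleton_mul hg0] at h1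
  have h4 := ih _ (by omega) (h.inf_singleton_mul hL hmin hlt hf hg hf0 hg0) rfl
  have h5 : s - 1 = finrank F ↥(span F {f} * S ⊓ span F {g} * S) - 1 + (finrank F A - 1) := by
    omega
  rw [h5]
  exact dvd_add h4 dvd_rfl

theorem finrank_eq_two (hL : ∀ K : IntermediateField F L, K = ⊥ ∨ K = ⊤)
    (hp : Nat.Prime (finrank F L - 2))
    (hmin : ∀ X, CriticalPair A X → finrank F A ≤ finrank F X) (h : CriticalPair A S) :
    finrank F A = 2 := by
  have h1 := h.finrank_sub_one_dvd hL hmin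
  have h2 := (h.dual hL).finrank_sub_one_dvd hL hmin
  have h3 := finrank_traceOrthogonal (A * S)
  have h4 := (h.dual hL).two_le_right
  obtain ⟨h5, h6, h7, h8⟩ := h
  have h9 : finrank F L - 2 = (finrank F A - 1) + (finrank F S - 1) +
      (finrank F (traceOrthogonal (A * S)) - 1) := by
    omega
  have h10 : finrank F A - 1 ∣ finrank F L - 2 := by
    rw [h9]
    exact dvd_add (dvd_add dvd_rfl h1) h2
  rcases (Nat.dvd_prime hp).1 h10 with h | h <;> omega

end CriticalPair

theorem isGeometric_of_finrank_le (hL : ∀ K : IntermediateField F L, K = ⊥ ∨ K = ⊤) {g : L}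
    (hg : g ∉ (⊥ : IntermediateField F L)) {X : Submodule F L} (h0 : X ≠ ⊥) (h1 : X ≠ ⊤)
    (h : finrank F ↥(span F {1, g} * X) ≤ finrank F X + 1) : IsGeometric g X := by
  have hg0 : g ≠ 0 := by
    rintro rfl
    exact hg (zero_mem _)
  obtain ⟨k, hk⟩ := Nat.exists_eq_succ_of_ne_zero (finrank_pos_of_ne_bot h0).ne'
  induction k generalizing X with
  | zero =>
    obtain ⟨w, hw, hw0⟩ := X.exists_mem_ne_zero_of_ne_bot h0
    refine ⟨w, hw0, 0, hk, ?_⟩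
    rw [pow_zero, mul_one]
    exact (eq_of_le_of_finrank_le ((span_singleton_le_iff_mem w X).2 hw)
      (by rw [finrank_span_singleton hw0]; omega)).symm
  | succ k ih =>
    have h2 := finrank_sup_add_finrank_inf_eq X (span F {g} * X)
    have h3 := finrank_inf_singleton_mul_lt hL h0 h1 hg
    rw [← span_pair_mul, finrank_span_singleton_mul hg0] at h2
    set W := span F {g⁻¹} * (X ⊓ span F {g} * X) with hW
    have hdW : finrank F W = k + 1 := by
      rw [hW, finrank_span_singleton_mul (inv_ne_zero hg0)]
      omega
    have hWX : W ≤ X := (mul_le_mul' le_rfl inf_le_right).trans (inv_singleton_mul hg0 X).le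
    have hgW : span F {g} * W ≤ X := by
      have := inv_singleton_mul (inv_ne_zero hg0) (X ⊓ span F {g} * X)
      rw [inv_inv] at this
      rw [hW, this]
      exact inf_le_left
    have hWX' : span F {1, g} * W ≤ X := by
      rw [span_pair_mul]
      exact sup_le hWX hgW
    have hW0 : W ≠ ⊥ := ne_bot_of_finrank_pos (by omega)
    have hW1 : W ≠ ⊤ := fun h => h1 (top_le_iff.1 (h ▸ hWX))
    obtain ⟨w, hw0, j, hj, hWw⟩ := ih hW0 hW1 ((finrank_mono hWX').trans (by omega)) hdW
    refine ⟨w, hw0, k + 1, hk, ?_⟩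
    have h4 := finrank_inf_singleton_mul_lt hL hW0 hW1 hg
    have h5 := finrank_sup_add_finrank_inf_eq W (span F {g} * W)
    rw [← span_pair_mul, finrank_span_singleton_mul hg0] at h5
    obtain rfl : j = k := by omega
    rw [← eq_of_le_of_finrank_le hWX' (by omega), hWw, pow_succ', mul_left_comm]

theorem succ_le_finrank_span_pair_pow [Algebra.IsSeparable F L]
    (hL : ∀ K : IntermediateField F L, K = ⊥ ∨ K = ⊤) {g : L}
    (hg : g ∉ (⊥ : IntermediateField F L)) {k : ℕ} (hk : span F {1, g} ^ k ≠ ⊤) :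
    k + 1 ≤ finrank F ↥(span F {1, g} ^ k) := by
  have h1 : (1 : Submodule F L) ≤ span F {1, g} := by
    rw [one_eq_span]
    exact span_mono (by simp)
  have hpow : ∀ j : ℕ, span F {1, g} ^ j ≠ ⊥ := fun j hj => by
    have := one_le_pow_of_one_le' h1 j
    rw [hj, le_bot_iff] at this
    exact one_ne_zero this
  induction k with
  | zero => exact finrank_pos_of_ne_bot (hpow 0)
  | succ k ih =>
    have hk' : span F {1, g} ^ k ≠ ⊤ := fun h =>
      hk (top_le_iff.1 (h ▸ pow_le_pow_right' h1 k.le_succ))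
    have h2 := finrank_inf_singleton_mul_lt hL (hpow k) hk' hg
    have h3 := finrank_sup_add_finrank_inf_eq (span F {1, g} ^ k) (span F {g} * span F {1, g} ^ k)
    have hg0 : g ≠ 0 := by
      rintro rfl
      exact hg (zero_mem _)
    rw [← span_pair_mul, finrank_span_singleton_mul hg0, ← pow_succ'] at h3
    have := ih hk'
    omega

theorem IsGeometric.of_criticalPair [Algebra.IsSeparable F L]
    (hL : ∀ K : IntermediateField F L, K = ⊥ ∨ K = ⊤) {g : L}
    (hg : g ∉ (⊥ : IntermediateField F L)) {X Y : Submodule F L} (hX : IsGeometric g X)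
    (h : CriticalPair X Y) : IsGeometric g Y := by
  obtain ⟨w, hw0, k, hk, hXw⟩ := hX
  refine isGeometric_of_finrank_le hL hg h.ne_bot_right h.ne_top_right ?_
  by_contra! hcon
  obtain ⟨h1, h2, h3, h4⟩ := h
  obtain ⟨k, rfl⟩ : ∃ j, k = j + 1 := ⟨k - 1, by omega⟩
  have h5 : finrank F ↥(span F {1, g} ^ k * (span F {1, g} * Y)) = finrank F ↥(X * Y) := by
    rw [hXw, mul_assoc, finrank_span_singleton_mul hw0, pow_succ, mul_assoc]
  have h6 := finrank_le_finrank_mul (span F {1, g} ^ k) (ne_bot_of_finrank_pos (by omega) :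
    span F {1, g} * Y ≠ ⊥)
  have h7 := succ_le_finrank_span_pair_pow hL hg (k := k) (ne_top_of_finrank_lt (by omega))
  have h8 := finrank_add_finrank_le_finrank_mul_add_one hL (X := span F {1, g} ^ k)
    (S := span F {1, g} * Y) (ne_bot_of_finrank_pos (by omega)) (ne_bot_of_finrank_pos (by omega))
    (ne_top_of_finrank_lt (by omega))
  omega

/-- Both members of a critical pair are geometric with the same ratio. -/
theorem CriticalPair.exists_isGeometric [Algebra.IsSeparable F L]
    (hL : ∀ K : IntermediateField F L, K = ⊥ ∨ K = ⊤) (hp : Nat.Prime (finrank F L - 2))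
    {S T : Submodule F L} (h : CriticalPair S T) :
    ∃ g : L, IsGeometric g S ∧ IsGeometric g T := by
  obtain ⟨A, ⟨hSA, B, hAB⟩, hAmin⟩ := exists_minimalFor_of_wellFoundedLT
    (fun A => Relation.ReflTransGen CriticalPair S A ∧ ∃ B, CriticalPair A B)
    (fun A => finrank F A) ⟨S, .refl, T, h⟩
  have hmin : ∀ X, CriticalPair A X → finrank F A ≤ finrank F X := fun X hX =>
    (le_total _ _).elim id fun hle => hAmin ⟨hSA.tail hX, A, hX.symm⟩ hle
  have hA2 := hAB.finrank_eq_two hL hp hmin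
  obtain ⟨x, hx, y, hy, hx0, hy0, hg⟩ := exists_mul_inv_notMem_bot hA2.ge
  have hle : span F {x} * span F {1, y * x⁻¹} ≤ A := by
    rw [mul_comm, span_pair_mul, span_mul_span, Set.singleton_mul_singleton,
      inv_mul_cancel_right₀ hx0]
    exact sup_le ((span_singleton_le_iff_mem x A).2 hx) ((span_singleton_le_iff_mem y A).2 hy)
  have hA : IsGeometric (y * x⁻¹) A := by
    refine ⟨x, hx0, 1, hA2, ?_⟩
    have h1 := finrank_mono hle
    rw [finrank_span_singleton_mul hx0, hA2, ← pow_one (span F {1, y * x⁻¹})] at h1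
    have h2 := hAB.finrank_mul_le
    have h3 := hAB.finrank_mul
    have h4 := hAB.two_le_right
    have h5 := succ_le_finrank_span_pair_pow hL hg (k := 1) (ne_top_of_finrank_lt (by omega))
    rw [pow_one] at h5 ⊢
    exact (eq_of_le_of_finrank_le hle (by rwa [finrank_span_singleton_mul hx0, hA2])).symm
  have hS : IsGeometric (y * x⁻¹) S := by
    clear hAmin h
    induction hSA using Relation.ReflTransGen.head_induction_on with
    | refl => exact hA
    | head hab _ ih => exact ih.of_criticalPair hL hg hab.symm
  exact ⟨y * x⁻¹, hS, hS.of_criticalPair hL hg h⟩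

end LinVosper

theorem stmt11 {F L : Type*} [Field F] [Field L] [Algebra F L]
    [FiniteDimensional F L] [Algebra.IsSeparable F L]
    (hL : ∀ K : IntermediateField F L, K = ⊥ ∨ K = ⊤)
    (hp : Nat.Prime (finrank F L - 2))
    (S T : Submodule F L)
    (hS2 : 2 ≤ finrank F ↥S) (hT2 : 2 ≤ finrank F ↥T)
    (hST2 : finrank F ↥(S * T) ≤ finrank F L - 2)
    (hST : finrank F ↥(S * T) = finrank F ↥S + finrank F ↥T - 1) :
    ∃ g g' a : L,
      (∃ bS : Basis (Fin (finrank F ↥S)) F ↥S, ∀ i, (bS i : L) = g * a ^ (i : ℕ)) ∧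
      (∃ bT : Basis (Fin (finrank F ↥T)) F ↥T, ∀ i, (bT i : L) = g' * a ^ (i : ℕ)) := by
  have hcrit : LinVosper.CriticalPair S T :=
    ⟨hS2, hT2, by omega, by have := hp.two_le; omega⟩
  obtain ⟨a, hS, hT⟩ := hcrit.exists_isGeometric hL hp
  obtain ⟨g, hg⟩ := hS.exists_basis
  obtain ⟨g', hg'⟩ := hT.exists_basis
  exact ⟨g, g', a, hg, hg'⟩
end

section
/- Let F be a finite field and L an extension of prime degree p of F. Let S, T be F-subspaces of L with 2 ≤ dim(S), dim(T) and dim(ST) ≤ p − 2. If dim(ST) = dim(S) + dim(T) − 1, then there are bases of S and T of the form {g, ga, …, g a^{dim S − 1}} and {g′, g′a, …, g′ a^{dim T − 1}} for some g, g′, a ∈ L. -/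
open Module Submodule

namespace LinearVosper

open scoped Pointwise

section Dimension

variable {F L : Type*} [Field F] [Field L] [Algebra F L]

theorem smul_mul_submodule (c : L) (S T : Submodule F L) : (c • S) * T = c • (S * T) :=
  smul_mul_assoc c S T

theorem mul_smul_submodule (c : L) (S T : Submodule F L) : S * (c • T) = c • (S * T) :=
  mul_smul_comm c S T

theorem mem_smul_iff {c : L} (hc : c ≠ 0) {S : Submodule F L} {x : L} :
    x ∈ c • S ↔ c⁻¹ * x ∈ S := by
  rw [mem_smul_pointwise_iff_exists]
  constructor
  · rintro ⟨s, hs, rfl⟩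
    simpa [hc] using hs
  · intro h
    exact ⟨_, h, by simp [hc]⟩

theorem finrank_smul {c : L} (hc : c ≠ 0) (S : Submodule F L) :
    finrank F ↥(c • S) = finrank F ↥S :=
  (LinearEquiv.finrank_eq (Submodule.equivMapOfInjective (LinearMap.mulLeft F c)
    (mul_right_injective₀ hc) S)).symm

/-- In an extension of prime degree, a nonzero subspace stable under multiplication by an
element outside the base field is everything. -/
theorem eq_top_of_smul_le (hp : (finrank F L).Prime) {a : L} (ha : a ∉ (⊥ : Subalgebra F L))
    {W : Submodule F L} (hW : W ≠ ⊥) (h : ∀ w ∈ W, a * w ∈ W) : W = ⊤ := by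
  have := Subalgebra.isSimpleOrder_of_finrank_prime F L hp
  let A : Subalgebra F L :=
    { carrier := {b | ∀ w ∈ W, b * w ∈ W}
      mul_mem' := fun {x y} hx hy w hw => by rw [mul_assoc]; exact hx _ (hy _ hw)
      add_mem' := fun {x y} hx hy w hw => by rw [add_mul]; exact add_mem (hx _ hw) (hy _ hw)
      algebraMap_mem' := fun r w hw => by
        rw [← Algebra.smul_def]; exact W.smul_mem r hw }
  have hA : A = ⊤ := by
    refine (eq_bot_or_eq_top A).resolve_left fun hbot => ha ?_
    rw [← hbot]
    exact h
  obtain ⟨w, hw, hw0⟩ := W.exists_mem_ne_zero_of_ne_bot hW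
  refine eq_top_iff.2 fun x _ => ?_
  have hx : x * w⁻¹ ∈ A := hA ▸ Algebra.mem_top
  simpa [hw0] using hx w hw

theorem exists_mem_ne_mul {S : Submodule F L} (hS : 2 ≤ finrank F S) {s : L} (hs : s ≠ 0) :
    ∃ t ∈ S, t * s⁻¹ ∉ (⊥ : Subalgebra F L) := by
  by_contra! h
  have hle : S ≤ span F {s} := fun t ht => by
    obtain ⟨r, hr⟩ := Algebra.mem_bot.1 (h t ht)
    refine mem_span_singleton.2 ⟨r, ?_⟩
    rw [Algebra.smul_def, hr]
    simp [hs]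
  have := finrank_mono hle
  have := finrank_span_singleton (K := F) hs
  omega

theorem inf_mul_sup_le (S T : Submodule F L) : (S ⊓ T) * (S ⊔ T) ≤ S * T := by
  rw [Submodule.mul_sup, sup_le_iff]
  exact ⟨(mul_le_mul_left inf_le_right S).trans_eq (mul_comm T S), mul_le_mul_left inf_le_left T⟩

/-- `S` and `T` satisfy the hypotheses of Vosper's theorem. -/
def VosperPair (S T : Submodule F L) : Prop :=
  2 ≤ finrank F S ∧ 2 ≤ finrank F T ∧ finrank F ↥(S * T) + 1 = finrank F S + finrank F T ∧
    finrank F ↥(S * T) + 2 ≤ finrank F L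

theorem ne_bot_of_two_le {S : Submodule F L} (h : 2 ≤ finrank F S) : S ≠ ⊥ := by
  rintro rfl
  simp at h

theorem ne_top_of_lt {S : Submodule F L} (h : finrank F S < finrank F L) : S ≠ ⊤ := by
  rintro rfl
  simp at h

theorem VosperPair.symm {S T : Submodule F L} (h : VosperPair S T) : VosperPair T S := by
  obtain ⟨h1, h2, h3, h4⟩ := h
  rw [mul_comm] at h3 h4
  exact ⟨h2, h1, by omega, h4⟩

theorem VosperPair.smul {S T : Submodule F L} (h : VosperPair S T) {c : L} (hc : c ≠ 0) :
    VosperPair S (c • T) := by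
  unfold VosperPair at *
  rwa [mul_smul_submodule, finrank_smul hc, finrank_smul hc]

/-- The orthogonal of a subspace for the trace form. -/
noncomputable def perp (W : Submodule F L) : Submodule F L := (Algebra.traceForm F L).orthogonal W

theorem mem_perp {W : Submodule F L} {c : L} :
    c ∈ perp W ↔ ∀ w ∈ W, Algebra.trace F L (c * w) = 0 := by
  simp only [perp, LinearMap.BilinForm.mem_orthogonal_iff,  Algebra.traceForm_apply, mul_comm c]

variable [FiniteDimensional F L]

/-- The linear Cauchy–Davenport inequality in extensions of prime degree. -/
theorem finrank_mul_ge (hp : (finrank F L).Prime) (S T : Submodule F L) (hS : S ≠ ⊥) (hT : T ≠ ⊥)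
    (hST : S * T ≠ ⊤) : finrank F S + finrank F T ≤ finrank F ↥(S * T) + 1 := by
  induction hn : finrank F S using Nat.strong_induction_on generalizing S T with
  | _ n ih =>
    subst hn
    obtain ⟨s, hs, hs0⟩ := S.exists_mem_ne_zero_of_ne_bot hS
    have hsT : s • T ≤ S * T := fun x hx => by
      obtain ⟨t, ht, rfl⟩ := (mem_smul_pointwise_iff_exists _ _ _).1 hx
      exact mul_mem_mul hs ht
    rcases Nat.lt_or_ge (finrank F S) 2 with h2 | h2
    · have := finrank_mono hsT
      rw [finrank_smul hs0] at this
      omega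
    obtain ⟨s', hs', hss⟩ := exists_mem_ne_mul h2 hs0
    have hTtop : T ≠ ⊤ := by
      rintro rfl
      apply hST
      refine eq_top_of_smul_le hp hss (fun h => ?_) (fun w hw => ?_)
      · rw [h, le_bot_iff] at hsT
        have := finrank_smul hs0 (⊤ : Submodule F L)
        rw [hsT, finrank_bot, finrank_top] at this
        exact hp.ne_zero this.symm
      · refine hsT ((mem_smul_iff hs0).2 mem_top)
    obtain ⟨t, ht, hts⟩ : ∃ t ∈ T, (s' * s⁻¹) * t ∉ T := by
      by_contra! h
      exact hTtop (eq_top_of_smul_le hp hss hT h)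
    have ht0 : t ≠ 0 := by rintro rfl; simp at hts
    set c := s * t⁻¹ with hc
    have hc0 : c ≠ 0 := by simp [hc, hs0, ht0]
    have hsc : s ∈ c • T := (mem_smul_iff hc0).2 (by simpa [hc, hs0, ht0] using ht)
    have hs'c : s' ∉ c • T := by
      rw [mem_smul_iff hc0]
      convert hts using 2
      simp [hc]; ring
    have hlt : finrank F ↥(S ⊓ c • T) < finrank F S :=
      finrank_lt_finrank_of_lt (inf_le_left.lt_of_ne fun h => hs'c (inf_eq_left.1 h hs'))
    have hle := inf_mul_sup_le S (c • T)
    rw [mul_smul_submodule] at hle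
    have htop : c • (S * T) ≠ ⊤ := fun h => hST <| eq_top_of_finrank_eq <| by
      rw [← finrank_smul hc0, h, finrank_top]
    have hbot : S ⊓ c • T ≠ ⊥ := fun h => hs0 <| (mem_bot F).1 (h ▸ ⟨hs, hsc⟩)
    have key := ih _ hlt (S ⊓ c • T) (S ⊔ c • T) hbot
      (fun h => hS (le_bot_iff.1 (h ▸ le_sup_left)))
      (fun h => htop (top_le_iff.1 (h ▸ hle))) rfl
    have h1 := finrank_mono hle
    have h2 := finrank_sup_add_finrank_inf_eq S (c • T)
    rw [finrank_smul hc0] at h1 h2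
    omega

theorem VosperPair.of_le (hp : (finrank F L).Prime) {S T : Submodule F L}
    (hS : 2 ≤ finrank F S) (hT : 2 ≤ finrank F T)
    (h : finrank F ↥(S * T) + 1 ≤ finrank F S + finrank F T)
    (h' : finrank F ↥(S * T) + 2 ≤ finrank F L) : VosperPair S T :=
  ⟨hS, hT, h.antisymm (finrank_mul_ge hp S T (ne_bot_of_two_le hS) (ne_bot_of_two_le hT)
    (ne_top_of_lt (by omega))), h'⟩

theorem VosperPair.inf_sup (hp : (finrank F L).Prime) {S T : Submodule F L} (h : VosperPair S T)
    (h2 : 2 ≤ finrank F ↥(S ⊓ T)) :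
    VosperPair (S ⊓ T) (S ⊔ T) ∧ (S ⊓ T) * (S ⊔ T) = S * T := by
  obtain ⟨h1, -, h3, h4⟩ := h
  have hle := inf_mul_sup_le S T
  have hdim := finrank_mono hle
  have hsum := finrank_sup_add_finrank_inf_eq S T
  have hsup : finrank F S ≤ finrank F ↥(S ⊔ T) := finrank_mono le_sup_left
  have hV : VosperPair (S ⊓ T) (S ⊔ T) :=
    .of_le hp h2 (by omega) (by omega) (by omega)
  exact ⟨hV, eq_of_le_of_finrank_le hle (by have := hV.2.2.1; omega)⟩

variable [Algebra.IsSeparable F L]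

theorem finrank_perp (W : Submodule F L) : finrank F (perp W) = finrank F L - finrank F W :=
  LinearMap.BilinForm.finrank_orthogonal (traceForm_nondegenerate F L) W

theorem VosperPair.perp (hp : (finrank F L).Prime) {S T : Submodule F L} (h : VosperPair S T) :
    VosperPair S (perp (S * T)) := by
  obtain ⟨h1, h2, h3, h4⟩ := h
  have hle : S * LinearVosper.perp (S * T) ≤ LinearVosper.perp T := by
    refine Submodule.mul_le.2 fun s hs c hc => mem_perp.2 fun t ht => ?_
    rw [mul_comm s c, mul_assoc]
    exact mem_perp.1 hc _ (mul_mem_mul hs ht)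
  have hdim := finrank_mono hle
  have e1 := finrank_perp T
  have e2 := finrank_perp (S * T)
  have := Submodule.finrank_le T
  exact .of_le hp h1 (by omega) (by omega) (by omega)

end Dimension

section Progression

variable {F L : Type*} [Field F] [Field L] [Algebra F L]

variable (F) in
/-- The span of the geometric progression `g, g x, …, g x ^ (d - 1)`. -/
def prog (g x : L) (d : ℕ) : Submodule F L := span F (Set.range fun i : Fin d => g * x ^ (i : ℕ))

theorem mem_prog (g x : L) {d i : ℕ} (hi : i < d) : g * x ^ i ∈ prog F g x d :=
  subset_span ⟨⟨i, hi⟩, rfl⟩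

theorem prog_le_iff {g x : L} {d : ℕ} {W : Submodule F L} :
    prog F g x d ≤ W ↔ ∀ i < d, g * x ^ i ∈ W := by
  rw [prog, span_le, Set.range_subset_iff]
  exact ⟨fun h i hi => h ⟨i, hi⟩, fun h i => h i i.2⟩

theorem smul_prog_le_iff {c g x : L} {d : ℕ} {W : Submodule F L} :
    c • prog F g x d ≤ W ↔ ∀ i < d, c * (g * x ^ i) ∈ W := by
  change (prog F g x d).map (LinearMap.mulLeft F c) ≤ W ↔ _
  rw [map_le_iff_le_comap, prog_le_iff]
  rfl

theorem prog_succ (g x : L) {d : ℕ} (hd : 0 < d) :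
    prog F g x (d + 1) = prog F g x d ⊔ x • prog F g x d := by
  apply le_antisymm
  · refine prog_le_iff.2 fun i hi => ?_
    rcases i with _ | i
    · exact mem_sup_left (mem_prog g x hd)
    · refine mem_sup_right ?_
      rw [pow_succ, ← mul_assoc, mul_comm]
      exact smul_mem_pointwise_smul _ x _ (mem_prog g x (by omega))
  · refine sup_le (prog_le_iff.2 fun i hi => mem_prog g x (by omega)) ?_
    refine smul_prog_le_iff.2 fun i hi => ?_
    rw [mul_left_comm, ← pow_succ']
    exact mem_prog g x (by omega)

/-- `Y` is spanned by a geometric progression of ratio `x`, with as many terms as its dimension. -/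
def IsProg (x : L) (Y : Submodule F L) : Prop := ∃ g, Y = prog F g x (finrank F Y)

theorem isProg_of_finrank_eq_two {Y : Submodule F L} (hY : finrank F Y = 2) :
    ∃ x ∉ (⊥ : Subalgebra F L), IsProg x Y := by
  obtain ⟨g, hg, hg0⟩ := Y.exists_mem_ne_zero_of_ne_bot (ne_bot_of_two_le hY.ge)
  obtain ⟨t, ht, htg⟩ := exists_mem_ne_mul hY.ge hg0
  have : FiniteDimensional F Y := finite_of_finrank_pos (by omega)
  refine ⟨t * g⁻¹, htg, g, ?_⟩
  have hle : prog F g (t * g⁻¹) 2 ≤ Y := by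
    refine prog_le_iff.2 fun i hi => ?_
    interval_cases i
    · simpa using hg
    · rw [pow_one, mul_comm t, mul_inv_cancel_left₀ hg0]
      exact ht
  have hgx := mem_prog (F := F) g (t * g⁻¹) (show 0 < 2 by simp)
  have htx := mem_prog (F := F) g (t * g⁻¹) (show 1 < 2 by simp)
  rw [pow_zero, mul_one] at hgx
  rw [show g * (t * g⁻¹) ^ 1 = t by field_simp] at htx
  rw [hY]
  refine (eq_of_le_of_finrank_le hle ?_).symm
  rw [hY]
  by_contra! hlt
  have : FiniteDimensional F (prog F g (t * g⁻¹) 2) := finiteDimensional_of_le hle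
  have hs : span F {g} = prog F g (t * g⁻¹) 2 := by
    refine eq_of_le_of_finrank_le ((span_singleton_le_iff_mem _ _).2 hgx) ?_
    rw [finrank_span_singleton hg0]
    omega
  rw [← hs] at htx
  obtain ⟨r, rfl⟩ := mem_span_singleton.1 htx
  apply htg
  rw [Algebra.smul_mul_assoc, mul_inv_cancel₀ hg0]
  exact Subalgebra.smul_mem _ (one_mem _) r

theorem ne_zero_of_notMem_bot {x : L} (hx : x ∉ (⊥ : Subalgebra F L)) : x ≠ 0 := by
  rintro rfl
  exact hx (zero_mem _)

variable [FiniteDimensional F L]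

theorem finrank_sup_smul_gt (hp : (finrank F L).Prime) {x : L} (hx : x ∉ (⊥ : Subalgebra F L))
    {Y : Submodule F L} (hY : Y ≠ ⊥) (hY' : Y ≠ ⊤) : finrank F Y < finrank F ↥(Y ⊔ x • Y) := by
  refine finrank_lt_finrank_of_lt (le_sup_left.lt_of_ne fun h => hY' ?_)
  refine eq_top_of_smul_le hp hx hY fun w hw => ?_
  rw [h]
  exact mem_sup_right (smul_mem_pointwise_smul w x Y hw)

/-- A subspace whose dimension grows by at most one when adding its translate by `x` is spanned
by a geometric progression of ratio `x`. -/
theorem isProg_of_finrank_sup_smul_le (hp : (finrank F L).Prime) {x : L}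
    (hx : x ∉ (⊥ : Subalgebra F L)) {Y : Submodule F L} (hY : Y ≠ ⊥) (hY' : Y ≠ ⊤)
    (h : finrank F ↥(Y ⊔ x • Y) ≤ finrank F Y + 1) : IsProg x Y := by
  have hx0 := ne_zero_of_notMem_bot hx
  induction hd : finrank F Y generalizing Y with
  | zero => exact absurd (finrank_eq_zero.1 hd) hY
  | succ d ih =>
    rcases Nat.eq_zero_or_pos d with rfl | hd0
    · obtain ⟨g, hg, hg0⟩ := Y.exists_mem_ne_zero_of_ne_bot hY
      refine ⟨g, ?_⟩
      rw [hd]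
      have hle : span F {g} ≤ Y := (span_singleton_le_iff_mem _ _).2 hg
      rw [← eq_of_le_of_finrank_le hle (by rw [hd, finrank_span_singleton hg0])]
      simp [prog]
    have hdim := finrank_sup_add_finrank_inf_eq Y (x • Y)
    have hgt := finrank_sup_smul_gt hp hx hY hY'
    rw [finrank_smul hx0] at hdim
    set Z : Submodule F L := x⁻¹ • (Y ⊓ x • Y) with hZ
    have hxZ : x • Z = Y ⊓ x • Y := smul_inv_smul₀ hx0 _
    have hZd : finrank F Z = d := by
      rw [hZ, finrank_smul (inv_ne_zero hx0)]
      omega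
    have hZY : Z ≤ Y := fun z hz => by
      have : x • z ∈ x • Z := smul_mem_pointwise_smul z x Z hz
      rw [hxZ] at this
      simpa [hx0] using (mem_smul_iff hx0).1 this.2
    have hsup : Z ⊔ x • Z ≤ Y := sup_le hZY (hxZ.trans_le inf_le_left)
    have hsupd := finrank_mono hsup
    have hZbot : Z ≠ ⊥ := by
      rintro h0
      rw [h0, finrank_bot] at hZd
      omega
    have hZtop : Z ≠ ⊤ := fun h0 => hY' (top_le_iff.1 (h0 ▸ hZY))
    have hZgt := finrank_sup_smul_gt hp hx hZbot hZtop
    obtain ⟨g, hg⟩ := ih hZbot hZtop (by omega) hZd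
    refine ⟨g, ?_⟩
    rw [hd, prog_succ g x hd0, ← hZd, ← hg]
    exact (eq_of_le_of_finrank_le hsup (by omega)).symm

/-- If one member of a Vosper pair is a geometric progression, the other one is a progression
of the same ratio. -/
theorem VosperPair.isProg (hp : (finrank F L).Prime) {x : L} (hx : x ∉ (⊥ : Subalgebra F L))
    {R Y : Submodule F L} (h : VosperPair R Y) (hR : IsProg x R) : IsProg x Y := by
  obtain ⟨h1, h2, h3, h4⟩ := h
  obtain ⟨g, hg⟩ := hR
  obtain ⟨r, hr⟩ : ∃ r, finrank F R = r + 1 := ⟨finrank F R - 1, by omega⟩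
  rw [hr] at hg
  have hle : prog F g x r * (Y ⊔ x • Y) ≤ R * Y := by
    rw [Submodule.mul_sup, mul_smul_submodule, ← smul_mul_submodule, ← Submodule.sup_mul, hg,
      prog_succ g x (by omega)]
  have hdim := finrank_mono hle
  have hrdim : r ≤ finrank F (prog F g x r) := by
    have hRle : R ≤ prog F g x r ⊔ span F {g * x ^ r} := by
      rw [hg]
      refine prog_le_iff.2 fun i hi => ?_
      rcases Nat.lt_succ_iff_lt_or_eq.1 hi with hi | rfl
      · exact mem_sup_left (mem_prog g x hi)
      · exact mem_sup_right (mem_span_singleton_self _)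
    have e1 := finrank_mono hRle
    have e2 := finrank_add_le_finrank_add_finrank (prog F g x r) (span F {g * x ^ r})
    have e3 := finrank_span_le_card (R := F) ({g * x ^ r} : Set L)
    simp only [Set.toFinset_singleton, Finset.card_singleton] at e3
    omega
  have hYlt : Y ≠ ⊤ := ne_top_of_lt (by omega)
  have hcd := finrank_mul_ge hp (prog F g x r) (Y ⊔ x • Y)
    (fun h0 => by rw [h0, finrank_bot] at hrdim; omega)
    (fun h0 => ne_bot_of_two_le h2 (le_bot_iff.1 (h0 ▸ le_sup_left)))
    (ne_top_of_lt (by omega))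
  exact isProg_of_finrank_sup_smul_le hp hx (ne_bot_of_two_le h2) hYlt (by omega)

end Progression

section Reduction

variable {F L : Type*} [Field F] [Field L] [Algebra F L]

theorem smul_sup_smul_le_mul {A B : Submodule F L} {a b : L} (ha : a ∈ A) (hb : b ∈ A) :
    a • B ⊔ b • B ≤ A * B := by
  refine sup_le ?_ ?_ <;>
  · intro x hx
    obtain ⟨t, ht, rfl⟩ := (mem_smul_pointwise_iff_exists _ _ _).1 hx
    exact mul_mem_mul (by assumption) ht

/-- A Vosper pair member that is not a geometric progression. -/
def IsBad (S : Submodule F L) : Prop :=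
  (∃ T, VosperPair S T) ∧ ∀ x ∉ (⊥ : Subalgebra F L), ¬ IsProg x S

variable [FiniteDimensional F L]

/-- If `B` meets its nontrivial translates in dimension at most one, two nonproportional
translates of `B` span a space of dimension at least `2 dim B - 1`. -/
theorem two_mul_finrank_le {B : Submodule F L}
    (hB : ∀ x ∉ (⊥ : Subalgebra F L), finrank F ↥(B ⊓ x • B) ≤ 1) {a b : L} (ha : a ≠ 0)
    (hb : b * a⁻¹ ∉ (⊥ : Subalgebra F L)) :
    2 * finrank F B ≤ finrank F ↥(a • B ⊔ b • B) + 1 := by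
  have h := hB _ hb
  have h0 := ne_zero_of_notMem_bot hb
  have hdim := finrank_sup_add_finrank_inf_eq B ((b * a⁻¹) • B)
  have hsm : a • (B ⊔ (b * a⁻¹) • B) = a • B ⊔ b • B := by
    rw [smul_sup', smul_smul]
    congr 2
    field_simp
  rw [← hsm, finrank_smul ha]
  rw [finrank_smul h0] at hdim
  omega

theorem IsBad.of_vosperPair (hp : (finrank F L).Prime) {S T : Submodule F L} (hS : IsBad S)
    (h : VosperPair S T) : IsBad T :=
  ⟨⟨S, h.symm⟩, fun x hx hT => hS.2 x hx (h.symm.isProg hp hx hT)⟩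

variable [Algebra.IsSeparable F L]

/-- A partner of least dimension meets its nontrivial translates in dimension at most one. -/
theorem VosperPair.finrank_inf_smul_le_one (hp : (finrank F L).Prime) {A B : Submodule F L}
    (h : VosperPair A B) (hmin : ∀ B', VosperPair A B' → finrank F B ≤ finrank F B')
    {x : L} (hx : x ∉ (⊥ : Subalgebra F L)) : finrank F ↥(B ⊓ x • B) ≤ 1 := by
  by_contra! hr
  have hx0 := ne_zero_of_notMem_bot hx
  have hC := hmin _ (h.perp hp)
  obtain ⟨h1, h2, h3, h4⟩ := h
  rw [finrank_perp] at hC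
  have hBtop : B ≠ ⊤ := ne_top_of_lt (by
    have := finrank_mul_ge hp A B (ne_bot_of_two_le h1) (ne_bot_of_two_le h2)
      (ne_top_of_lt (by omega))
    omega)
  have hgt := finrank_sup_smul_gt hp hx (ne_bot_of_two_le h2) hBtop
  have hdim := finrank_sup_add_finrank_inf_eq B (x • B)
  rw [finrank_smul hx0] at hdim
  have hinf : A * (B ⊓ x • B) ≤ A * B ⊓ x • (A * B) := by
    rw [← mul_smul_submodule]
    exact le_inf (mul_le_mul' le_rfl inf_le_left) (mul_le_mul' le_rfl inf_le_right)
  have hinfd := finrank_mono hinf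
  have hinfd' : finrank F ↥(A * (B ⊓ x • B)) ≤ finrank F ↥(A * B) :=
    finrank_mono (hinf.trans inf_le_left)
  have hnot : ¬ VosperPair A (B ⊓ x • B) := fun hV => by
    have := hmin _ hV
    omega
  have hlarge : finrank F A + finrank F ↥(B ⊓ x • B) ≤ finrank F ↥(A * (B ⊓ x • B)) := by
    by_contra! hlt
    exact hnot (.of_le hp h1 hr (by omega) (by omega))
  have hAB := finrank_sup_add_finrank_inf_eq (A * B) (x • (A * B))
  rw [finrank_smul hx0, ← mul_smul_submodule, ← Submodule.mul_sup, mul_smul_submodule] at hAB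
  have hcd := finrank_mul_ge hp A (B ⊔ x • B) (ne_bot_of_two_le h1)
    (fun h0 => ne_bot_of_two_le h2 (le_bot_iff.1 (h0 ▸ le_sup_left))) (ne_top_of_lt (by omega))
  omega

/-- A counterexample of least dimension can be taken of the form `(A, A)`, where `A` meets its
nontrivial translates in dimension at most one. -/
theorem IsBad.exists_self_pair (hp : (finrank F L).Prime) {S : Submodule F L} (hS : IsBad S) :
    ∃ A : Submodule F L, 3 ≤ finrank F A ∧ VosperPair A A ∧
      ∀ x ∉ (⊥ : Subalgebra F L), finrank F ↥(A ⊓ x • A) ≤ 1 := by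
  obtain ⟨A, hA, hAmin⟩ := exists_minimalFor_of_wellFoundedLT (IsBad (F := F) (L := L))
    (fun A => finrank F A) ⟨S, hS⟩
  obtain ⟨B, hAB, hBmin⟩ := exists_minimalFor_of_wellFoundedLT (VosperPair A)
    (fun A => finrank F A) hA.1
  have hAmin' : ∀ R : Submodule F L, IsBad R → finrank F A ≤ finrank F R := fun R hR => by
    rcases le_total (finrank F A) (finrank F R) with h | h
    · exact h
    · exact hAmin hR h
  have hBmin' : ∀ R : Submodule F L, VosperPair A R → finrank F B ≤ finrank F R := fun R hR => by
    rcases le_total (finrank F B) (finrank F R) with h | h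
    · exact h
    · exact hBmin hR h
  have hB := hAmin' B (hA.of_vosperPair hp hAB)
  have hsid := fun x hx => hAB.finrank_inf_smul_le_one hp hBmin' (x := x) hx
  have hA3 : 3 ≤ finrank F A := by
    by_contra! h
    obtain ⟨x, hx, hxA⟩ := isProg_of_finrank_eq_two (show finrank F A = 2 by
      have := hAB.1
      omega)
    exact hA.2 x hx hxA
  obtain ⟨a, ha, ha0⟩ := A.exists_mem_ne_zero_of_ne_bot (ne_bot_of_two_le hAB.1)
  obtain ⟨b, hb, hba⟩ := exists_mem_ne_mul hAB.1 ha0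
  have hb0 : b ≠ 0 := by
    rintro rfl
    simp [zero_mem] at hba
  have hge := two_mul_finrank_le hsid ha0 hba
  have hle := finrank_mono (smul_sup_smul_le_mul (B := B) ha hb)
  have heq : finrank F B = finrank F A := by
    have := hAB.2.2.1
    omega
  obtain ⟨w, hw, hw0⟩ : ∃ w ∈ a • B ⊓ b • B, w ≠ 0 := by
    refine exists_mem_ne_zero_of_ne_bot fun h0 => ?_
    have := finrank_sup_add_finrank_inf_eq (a • B) (b • B)
    rw [h0, finrank_bot, finrank_smul ha0, finrank_smul hb0] at this
    have := hAB.2.2.1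
    omega
  have hwa := (mem_smul_iff ha0).1 hw.1
  have hwb := (mem_smul_iff hb0).1 hw.2
  set c := a * b * w⁻¹ with hc
  have hc0 : c ≠ 0 := by simp [hc, ha0, hb0, hw0]
  have hac : a ∈ c • B := (mem_smul_iff hc0).2 (by convert hwb using 1; rw [hc]; field_simp)
  have hbc : b ∈ c • B := (mem_smul_iff hc0).2 (by convert hwa using 1; rw [hc]; field_simp)
  have hr : 2 ≤ finrank F ↥(A ⊓ c • B) := by
    by_contra! hlt
    have hspan : span F {a} = A ⊓ c • B := by
      refine eq_of_le_of_finrank_le ((span_singleton_le_iff_mem _ _).2 ⟨ha, hac⟩) ?_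
      rw [finrank_span_singleton ha0]
      omega
    obtain ⟨r, rfl⟩ := mem_span_singleton.1 (hspan ▸ ⟨hb, hbc⟩ : b ∈ span F {a})
    apply hba
    rw [Algebra.smul_mul_assoc, mul_inv_cancel₀ ha0]
    exact Subalgebra.smul_mem _ (one_mem _) r
  have hAcB := hAB.smul hc0
  obtain ⟨hV, hVeq⟩ := hAcB.inf_sup hp hr
  have hAeq : A = c • B := by
    by_contra hne
    have hlt : finrank F ↥(A ⊓ c • B) < finrank F A := by
      refine finrank_lt_finrank_of_lt (inf_le_left.lt_of_ne fun h => hne ?_)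
      exact eq_of_le_of_finrank_le (inf_eq_left.1 h) (by rw [finrank_smul hc0, heq])
    obtain ⟨x, hx, hxR⟩ : ∃ x ∉ (⊥ : Subalgebra F L), IsProg x (A ⊓ c • B) := by
      by_contra! h
      exact absurd (hAmin' _ ⟨⟨_, hV⟩, h⟩) (by omega)
    have hU := (hV.perp hp).isProg hp hx hxR
    rw [hVeq] at hU
    exact hA.2 x hx ((hAcB.perp hp).symm.isProg hp hx hU)
  refine ⟨A, hA3, ?_, fun x hx => ?_⟩
  · rwa [← hAeq] at hAcB
  · have hxA : A ⊓ x • A = c • (B ⊓ x • B) := by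
      ext y
      rw [hAeq, smul_comm, mem_inf, mem_smul_iff hc0, mem_smul_iff hc0, mem_smul_iff hc0, mem_inf]
    rw [hxA, finrank_smul hc0]
    exact hsid x hx

end Reduction

section CharacterSum

open scoped ComplexConjugate

theorem exists_anisotropic (F : Type*) [Field F] [Finite F] :
    ∃ n : F, ∀ s : F, s ^ 2 + s + n ≠ 0 := by
  by_contra! h
  have hsurj : Function.Surjective fun s : F => -(s ^ 2 + s) := fun n => by
    obtain ⟨s, hs⟩ := h n
    exact ⟨s, by linear_combination -hs⟩
  have hinj := Finite.injective_iff_surjective.2 hsurj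
  have : (0 : F) = -1 := hinj (by ring)
  simp at this

variable {F : Type*} [Field F]

theorem sum_addChar_linearMap {V : Type*} [AddCommGroup V] [Module F V] [Fintype V]
    {ψ : AddChar F ℂ} (hψ : ψ ≠ 1) (f : V →ₗ[F] F) [Decidable (f = 0)] :
    ∑ v, ψ (f v) = if f = 0 then (Fintype.card V : ℂ) else 0 := by
  split_ifs with h
  · simp [h]
  · have : ψ.compAddMonoidHom f.toAddMonoidHom ≠ 0 := fun h0 => by
      obtain ⟨a, ha⟩ := AddChar.ne_one_iff.1 hψ
      obtain ⟨v, rfl⟩ := LinearMap.surjective h a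
      exact ha (DFunLike.congr_fun h0 v)
    exact AddChar.sum_eq_zero_iff_ne_zero.2 this

/-- The exponential sum of the binary norm form `s ^ 2 + s t + n t ^ 2` twisted by the bilinear
form `B`. -/
noncomputable def normSum {V : Type*} [AddCommGroup V] [Module F V] [Fintype V] (ψ : AddChar F ℂ)
    (n : F) (B : LinearMap.BilinForm F V) : ℂ :=
  ∑ v : V × V, ψ (B v.1 v.1 + B v.1 v.2 + n * B v.2 v.2)

theorem normSum_eq_mul {V : Type*} [AddCommGroup V] [Module F V] [Fintype V] (ψ : AddChar F ℂ)
    (n : F) (B : LinearMap.BilinForm F V) {W W' : Submodule F V} [Fintype W] [Fintype W']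
    (hc : IsCompl W W') (h : ∀ w ∈ W, ∀ w' ∈ W', B w w' = 0) (h' : ∀ w ∈ W, ∀ w' ∈ W', B w' w = 0) :
    normSum ψ n B = normSum ψ n (B.restrict W) * normSum ψ n (B.restrict W') := by
  let e := (prodEquivOfIsCompl W W' hc).toEquiv
  rw [normSum, normSum, normSum, Fintype.sum_mul_sum, ← Fintype.sum_prod_type']
  refine (Fintype.sum_equiv ((Equiv.prodProdProdComm W W W' W').trans (e.prodCongr e)) _ _ ?_).symm
  rintro ⟨⟨a, b⟩, ⟨c, d⟩⟩
  rw [← AddChar.map_add_eq_mul]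
  congr 1
  simp [e, h _ a.2 _ c.2, h' _ a.2 _ c.2, h _ a.2 _ d.2, h' _ b.2 _ c.2, h _ b.2 _ d.2,
    h' _ b.2 _ d.2]
  ring

variable [Fintype F]

local notation "q" => Fintype.card F

theorem norm_sum_eq_card {ψ : AddChar F ℂ} (hψ : ψ ≠ 1) {n : F} (hn : ∀ s : F, s ^ 2 + s + n ≠ 0)
    {b : F} (hb : b ≠ 0) :
    Complex.normSq (∑ v : F × F, ψ (b * (v.1 ^ 2 + v.1 * v.2 + n * v.2 ^ 2))) = (q : ℝ) ^ 2 := by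
  classical
  set N : F × F → F := fun v => v.1 ^ 2 + v.1 * v.2 + n * v.2 ^ 2 with hN
  have hdisc : 1 - 4 * n ≠ 0 := fun h => by
    have h2 : (2 : F) ≠ 0 := fun h2 => one_ne_zero (α := F) (by linear_combination h + 2 * n * h2)
    apply hn (-1 / 2)
    field_simp
    linear_combination -h
  let f : F × F → (F × F →ₗ[F] F) := fun u =>
    (b * (2 * u.1 + u.2)) • LinearMap.fst F F F + (b * (u.1 + 2 * n * u.2)) • LinearMap.snd F F F
  have hf : ∀ u, f u = 0 ↔ u = 0 := fun u => by
    constructor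
    · intro h
      have h1 := DFunLike.congr_fun h (1, 0)
      have h2 := DFunLike.congr_fun h (0, 1)
      simp only [f, LinearMap.add_apply, LinearMap.smul_apply, LinearMap.fst_apply,
        LinearMap.snd_apply, smul_eq_mul, mul_one, mul_zero, add_zero, zero_add,
        LinearMap.zero_apply, mul_eq_zero, hb, false_or] at h1 h2
      have e1 : u.1 = 0 := (mul_eq_zero.1 (by linear_combination -2 * n * h1 + h2 :
        (1 - 4 * n) * u.1 = 0)).resolve_left hdisc
      have e2 : u.2 = 0 := by simpa [e1] using h1
      exact Prod.ext e1 e2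
    · rintro rfl
      simp [f]
  have key : (∑ v, ψ (b * N v)) * conj (∑ v, ψ (b * N v)) = (q : ℂ) ^ 2 := by
    calc _ = ∑ w, ∑ u, ψ (b * N u) * ψ (f u w) := by
          rw [map_sum, Finset.mul_sum]
          refine Finset.sum_congr rfl fun w _ => ?_
          rw [Finset.sum_mul]
          refine Fintype.sum_equiv (Equiv.subRight w) _ _ fun v => ?_
          rw [← AddChar.map_neg_eq_conj, ← AddChar.map_add_eq_mul, ← AddChar.map_add_eq_mul]
          congr 1
          simp [hN, f]
          ring
      _ = ∑ u, ψ (b * N u) * ∑ w, ψ (f u w) := by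
          rw [Finset.sum_comm]
          simp_rw [Finset.mul_sum]
      _ = _ := by
          simp_rw [sum_addChar_linearMap hψ, hf]
          simp [hN, sq]
  rw [Complex.mul_conj] at key
  exact_mod_cast key

theorem sum_addChar_normForm {ψ : AddChar F ℂ} (hψ : ψ ≠ 1) {n : F}
    (hn : ∀ s : F, s ^ 2 + s + n ≠ 0) {b : F} (hb : b ≠ 0) :
    ∑ v : F × F, ψ (b * (v.1 ^ 2 + v.1 * v.2 + n * v.2 ^ 2)) = -(q : ℂ) := by
  classical
  set T : F → ℂ := fun b => ∑ v : F × F, ψ (b * (v.1 ^ 2 + v.1 * v.2 + n * v.2 ^ 2)) with hT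
  have hsq : ∀ b ≠ 0, (T b).re ^ 2 + (T b).im ^ 2 = (q : ℝ) ^ 2 := fun b hb => by
    rw [← norm_sum_eq_card hψ hn hb, Complex.normSq_apply]
    ring
  have hzero : ∀ v : F × F, v.1 ^ 2 + v.1 * v.2 + n * v.2 ^ 2 = 0 ↔ v = 0 := fun v => by
    constructor
    · intro h
      by_cases h2 : v.2 = 0
      · exact Prod.ext (by simpa [h2] using h) h2
      · exfalso
        apply hn (v.1 / v.2)
        field_simp
        linear_combination h
    · rintro rfl
      simp
  have hsum : ∑ b, T b = q := by
    rw [hT, Finset.sum_comm]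
    have : ∀ v : F × F, ∑ b, ψ (b * (v.1 ^ 2 + v.1 * v.2 + n * v.2 ^ 2)) =
        if v = 0 then (q : ℂ) else 0 := fun v => by
      have h := sum_addChar_linearMap hψ
        (LinearMap.mulRight F (v.1 ^ 2 + v.1 * v.2 + n * v.2 ^ 2))
      simp only [LinearMap.mulRight_apply] at h
      rw [h]
      simp only [LinearMap.mulRight_eq_zero_iff, hzero]
    simp [this]
  have hT0 : T 0 = (q : ℂ) ^ 2 := by simp [hT, sq]
  have hre : ∑ b ∈ Finset.univ.erase 0, ((T b).re + q) = 0 := by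
    have h1 := Finset.add_sum_erase Finset.univ T (Finset.mem_univ 0)
    rw [hsum, hT0] at h1
    have h2 := congrArg Complex.re h1
    have hq : ((q : ℂ) ^ 2).re = (q : ℝ) ^ 2 := by norm_cast
    rw [Complex.add_re, hq, Complex.re_sum, Complex.natCast_re] at h2
    rw [Finset.sum_add_distrib, Finset.sum_const, Finset.card_erase_of_mem (Finset.mem_univ _),
      Finset.card_univ, nsmul_eq_mul, Nat.cast_sub Fintype.card_pos]
    push_cast
    linear_combination h2
  have hnonneg : ∀ b ∈ Finset.univ.erase (0 : F), 0 ≤ (T b).re + q := fun b hb => by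
    have := abs_le_of_sq_le_sq' (a := (T b).re) (b := q) (by
      rw [← hsq b (Finset.ne_of_mem_erase hb)]
      exact le_add_of_nonneg_right (sq_nonneg _)) (Nat.cast_nonneg _)
    linarith [this.1]
  have hb' := (Finset.sum_eq_zero_iff_of_nonneg hnonneg).1 hre b
    (Finset.mem_erase.2 ⟨hb, Finset.mem_univ _⟩)
  have hbre : (T b).re = -q := by linarith
  have hbim : (T b).im = 0 := by
    have := hsq b hb
    rw [hbre] at this
    exact pow_eq_zero_iff (two_ne_zero) |>.1 (by linarith)
  exact Complex.ext (hbre.trans (by simp)) (hbim.trans (by simp))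

theorem normSum_zero {V : Type*} [AddCommGroup V] [Module F V] [Fintype V] (ψ : AddChar F ℂ)
    (n : F) : normSum ψ n (0 : LinearMap.BilinForm F V) = (q : ℂ) ^ (2 * finrank F V) := by
  simp [normSum, Module.card_eq_pow_finrank (K := F) (V := V), two_mul, pow_add]

theorem normSum_alternating {V : Type*} [AddCommGroup V] [Module F V] [Fintype V]
    {ψ : AddChar F ℂ} (hψ : ψ ≠ 1) (n : F) {B : LinearMap.BilinForm F V} (halt : ∀ v, B v v = 0)
    (hB : ∀ x, B x = 0 → x = 0) : normSum ψ n B = (q : ℂ) ^ finrank F V := by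
  classical
  have hB' : ∀ x, B x = 0 ↔ x = 0 := fun x => ⟨hB x, fun h => by simp [h]⟩
  simp only [normSum, halt, zero_add, mul_zero, add_zero, Fintype.sum_prod_type]
  simp [sum_addChar_linearMap hψ, hB', Module.card_eq_pow_finrank (K := F) (V := V)]

theorem normSum_span_singleton {V : Type*} [AddCommGroup V] [Module F V] {ψ : AddChar F ℂ}
    (hψ : ψ ≠ 1) {n : F} (hn : ∀ s : F, s ^ 2 + s + n ≠ 0) (B : LinearMap.BilinForm F V) {v : V}
    (hv : B v v ≠ 0) [Fintype (span F {v})] : normSum ψ n (B.restrict (span F {v})) = -(q : ℂ) := by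
  have hv0 : v ≠ 0 := by
    rintro rfl
    simp at hv
  rw [← sum_addChar_normForm hψ hn hv, normSum]
  let e := (LinearEquiv.toSpanNonzeroSingleton F V v hv0).toEquiv
  refine (Fintype.sum_equiv (e.prodCongr e) _ _ fun v => ?_).symm
  congr 1
  simp [e]
  ring

/-- A nonisotropic vector, or else a hyperbolic plane, splits off a nonzero symmetric form. -/
theorem normSum_nondegenerate {ψ : AddChar F ℂ} (hψ : ψ ≠ 1) {n : F}
    (hn : ∀ s : F, s ^ 2 + s + n ≠ 0) {V : Type*} [AddCommGroup V] [Module F V] [Fintype V]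
    (B : LinearMap.BilinForm F V) (hsymm : ∀ x y, B x y = B y x) (hB : ∀ x, B x = 0 → x = 0) :
    normSum ψ n B = (-(q : ℂ)) ^ finrank F V := by
  classical
  induction hd : finrank F V using Nat.strong_induction_on generalizing V with
  | _ d ih =>
  have split : ∀ W : Submodule F V, W ≠ ⊥ → Disjoint W (B.orthogonal W) →
      normSum ψ n (B.restrict W) = (-(q : ℂ)) ^ finrank F W →
      normSum ψ n B = (-(q : ℂ)) ^ d := by
    intro W hW hdisj hWsum
    have hrefl : B.IsRefl := fun x y h => by rw [hsymm, h]
    have hc := (LinearMap.BilinForm.isCompl_orthogonal_iff_disjoint hrefl).2 hdisj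
    have hadd := finrank_add_eq_of_isCompl hc
    have hpos : 0 < finrank F W := Nat.pos_of_ne_zero fun h => hW (finrank_eq_zero.1 h)
    have hperp := ih (finrank F (B.orthogonal W)) (by omega) (B.restrict (B.orthogonal W))
      (fun x y => hsymm x y) (fun x hx => by
        have : B (x : V) = 0 := by
          ext y
          obtain ⟨w, hw, w', hw', rfl⟩ := mem_sup.1 (hc.sup_eq_top ▸ mem_top : y ∈ W ⊔ _)
          have h1 : B (x : V) w = 0 := by rw [hsymm]; exact x.2 w hw
          have h2 : B (x : V) w' = 0 := DFunLike.congr_fun hx (⟨w', hw'⟩ : B.orthogonal W)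
          simp [h1, h2]
        exact Subtype.ext (hB _ this)) rfl
    rw [normSum_eq_mul ψ n B hc (fun w hw w' hw' => hw' w hw)
      (fun w hw w' hw' => by rw [hsymm]; exact hw' w hw), hWsum, hperp, ← pow_add, hadd, hd]
  by_cases hani : ∃ v, B v v ≠ 0
  · obtain ⟨v, hv⟩ := hani
    have hv0 : v ≠ 0 := by
      rintro rfl
      simp at hv
    refine split (span F {v}) (by simpa using hv0) ?_ ?_
    · rw [disjoint_def]
      intro x hx hx'
      obtain ⟨a, rfl⟩ := mem_span_singleton.1 hx
      have := hx' v (mem_span_singleton_self v)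
      simp_all
    · rw [normSum_span_singleton hψ hn B hv, finrank_span_singleton hv0, pow_one]
  push Not at hani
  by_cases hV : ∀ v : V, v = 0
  · have hd0 : d = 0 := by
      rw [← hd]
      have : Subsingleton V := ⟨fun a b => by rw [hV a, hV b]⟩
      exact finrank_zero_of_subsingleton
    subst hd0
    rw [normSum_alternating hψ n hani hB, hd, pow_zero, pow_zero]
  push Not at hV
  obtain ⟨u, hu⟩ := hV
  obtain ⟨w, hw⟩ : ∃ w, B u w ≠ 0 := by
    by_contra! h
    exact hu (hB u (LinearMap.ext h))
  have hwu : B w u ≠ 0 := by rwa [hsymm]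
  have hzero : ∀ a b : F, B u (a • u + b • w) = 0 → B w (a • u + b • w) = 0 → a = 0 ∧ b = 0 := by
    intro a b h1 h2
    simp_all
  have hplane : ∀ x ∈ span F {u, w}, B u x = 0 → B w x = 0 → x = 0 := by
    intro x hx h1 h2
    obtain ⟨a, b, rfl⟩ := mem_span_pair.1 hx
    obtain ⟨rfl, rfl⟩ := hzero a b h1 h2
    simp
  have hfr : finrank F (span F {u, w}) = 2 := by
    have hli : LinearIndependent F ![u, w] := LinearIndependent.pair_iff.2 fun a b h =>
      hzero a b (by simp [h]) (by simp [h])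
    have h := finrank_span_eq_card hli
    rwa [Matrix.range_cons, Matrix.range_cons_empty, Set.singleton_union] at h
  have hum : u ∈ span F {u, w} := subset_span (by simp)
  have hwm : w ∈ span F {u, w} := subset_span (by simp)
  refine split (span F {u, w}) (fun h => hu ?_) ?_ ?_
  · rw [h] at hum
    simpa using hum
  · exact disjoint_def.2 fun x hx hx' => hplane x hx (hx' u hum) (hx' w hwm)
  · rw [normSum_alternating hψ n (B := B.restrict (span F {u, w})) (fun v => hani v)
      fun x hx => Subtype.ext (hplane x x.2 ?_ ?_), hfr, neg_sq]
    · rw [hsymm]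
      exact DFunLike.congr_fun hx ⟨u, hum⟩
    · rw [hsymm]
      exact DFunLike.congr_fun hx ⟨w, hwm⟩

theorem normSum_symmetric {ψ : AddChar F ℂ} (hψ : ψ ≠ 1) {n : F}
    (hn : ∀ s : F, s ^ 2 + s + n ≠ 0) {V : Type*} [AddCommGroup V] [Module F V] [Fintype V]
    (B : LinearMap.BilinForm F V) (hsymm : ∀ x y, B x y = B y x) :
    normSum ψ n B = (q : ℂ) ^ (2 * finrank F (LinearMap.ker B)) *
      (-(q : ℂ)) ^ (finrank F V - finrank F (LinearMap.ker B)) := by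
  classical
  obtain ⟨W, hW⟩ := Submodule.exists_isCompl (LinearMap.ker B)
  have hadd := finrank_add_eq_of_isCompl hW
  have hl : ∀ x ∈ LinearMap.ker B, ∀ y, B x y = 0 := fun x hx y => by
    rw [LinearMap.mem_ker.1 hx, LinearMap.zero_apply]
  have hr : ∀ x ∈ LinearMap.ker B, ∀ y, B y x = 0 := fun x hx y => by rw [hsymm, hl x hx]
  have hker : B.restrict (LinearMap.ker B) = 0 := by
    ext x y
    exact hl x x.2 y
  rw [normSum_eq_mul ψ n B hW (fun w hw w' _ => hl w hw w') (fun w hw w' _ => hr w hw w'), hker,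
    normSum_zero, normSum_nondegenerate hψ hn (B.restrict W) (fun x y => hsymm x y)
      (fun x hx => ?_), ← hadd, Nat.add_sub_cancel_left]
  refine Subtype.ext (disjoint_def.1 hW.disjoint x (LinearMap.mem_ker.2 (LinearMap.ext fun y => ?_))
    x.2)
  obtain ⟨k, hk, w, hw, rfl⟩ := mem_sup.1 (hW.sup_eq_top ▸ mem_top : y ∈ _ ⊔ W)
  have h1 : B (x : V) w = 0 := DFunLike.congr_fun hx (⟨w, hw⟩ : W)
  simp [hr k hk, h1]

end CharacterSum

section Counting

variable {F L : Type*} [Field F] [Field L] [Algebra F L]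

/-- The bilinear form `(x, y) ↦ Tr (c x y)`. -/
noncomputable def twistedTrace (F : Type*) {L : Type*} [Field F] [Field L] [Algebra F L] (c : L) :
    LinearMap.BilinForm F L :=
  (LinearMap.mul F L).compr₂ (Algebra.trace F L ∘ₗ LinearMap.mulLeft F c)

theorem twistedTrace_apply (c x y : L) :
    twistedTrace F c x y = Algebra.trace F L (c * (x * y)) := rfl

theorem mem_perp_smul {A : Submodule F L} {c x : L} :
    c ∈ perp (x • A) ↔ ∀ y ∈ A, twistedTrace F c x y = 0 := by
  refine ⟨fun h y hy => mem_perp.1 h _ (smul_mem_pointwise_smul y x A hy), fun h => ?_⟩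
  refine mem_perp.2 fun w hw => ?_
  obtain ⟨y, hy, rfl⟩ := hw
  exact h y hy

theorem restrict_twistedTrace_eq_zero_iff {A : Submodule F L} {c : L} {x : A} :
    (twistedTrace F c).restrict A x = 0 ↔ c ∈ perp ((x : L) • A) := by
  rw [mem_perp_smul]
  exact ⟨fun h y hy => DFunLike.congr_fun h (⟨y, hy⟩ : A), fun h => LinearMap.ext fun y => h y y.2⟩

variable [FiniteDimensional F L]

theorem sq_add_add_ne_zero (hp : (finrank F L).Prime) (hp2 : 2 < finrank F L) {n : F}
    (hn : ∀ s : F, s ^ 2 + s + n ≠ 0) (y : L) : y ^ 2 + y + algebraMap F L n ≠ 0 := by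
  intro hy
  have hyint : IsIntegral F y := .of_finite F y
  have hle : (minpoly F y).natDegree ≤ 2 := by
    have hm : (Polynomial.X ^ 2 + Polynomial.X + Polynomial.C n : Polynomial F).natDegree = 2 := by
      compute_degree!
    rw [← hm]
    refine Polynomial.natDegree_le_natDegree (minpoly.degree_le_of_ne_zero F y ?_ (by simpa using hy))
    exact Polynomial.ne_zero_of_natDegree_gt (n := 1) (by omega)
  rcases (Nat.dvd_prime hp).1 (minpoly.degree_dvd hyint) with h | h
  · obtain ⟨s, rfl⟩ := minpoly.natDegree_eq_one_iff.1 h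
    apply hn s
    apply (algebraMap F L).injective
    simpa using hy
  · omega

theorem sq_add_mul_add_eq_zero_iff (hp : (finrank F L).Prime) (hp2 : 2 < finrank F L) {n : F}
    (hn : ∀ s : F, s ^ 2 + s + n ≠ 0) (x y : L) :
    x * x + x * y + algebraMap F L n * (y * y) = 0 ↔ x = 0 ∧ y = 0 := by
  refine ⟨fun h => ?_, by rintro ⟨rfl, rfl⟩; simp⟩
  by_cases hy : y = 0
  · exact ⟨by simpa [hy] using h, hy⟩
  · refine absurd ?_ (sq_add_add_ne_zero hp hp2 hn (x / y))
    field_simp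
    linear_combination h

/-- If `A` is a Sidon space with `dim (A * A) = 2 dim A - 1`, the forms `Tr (c x y)` on `A` are
either zero or have a radical of dimension at most one. -/
theorem finrank_ker_twistedTrace_le {A : Submodule F L} (hA : VosperPair A A)
    (hsid : ∀ x ∉ (⊥ : Subalgebra F L), finrank F ↥(A ⊓ x • A) ≤ 1) {c : L}
    (hc : c ∉ perp (A * A)) : finrank F (LinearMap.ker ((twistedTrace F c).restrict A)) ≤ 1 := by
  by_contra! hlt
  set K := (LinearMap.ker ((twistedTrace F c).restrict A)).map A.subtype with hK
  have hKr : 2 ≤ finrank F K := by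
    rw [hK, finrank_map_subtype_eq]
    exact hlt
  have hmem : ∀ x ∈ K, x ∈ A ∧ c ∈ perp (x • A) := by
    rintro _ ⟨x, hx, rfl⟩
    exact ⟨x.2, restrict_twistedTrace_eq_zero_iff.1 hx⟩
  obtain ⟨x, hx, hx0⟩ := K.ne_bot_iff.1 (ne_bot_of_two_le hKr)
  obtain ⟨t, ht, htx⟩ := exists_mem_ne_mul hKr hx0
  have hge := two_mul_finrank_le hsid hx0 htx
  have hle := smul_sup_smul_le_mul (B := A) (hmem x hx).1 (hmem t ht).1
  have heq := eq_of_le_of_finrank_le hle (by have := hA.2.2.1; omega)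
  apply hc
  rw [← heq]
  refine mem_perp.2 fun w hw => ?_
  obtain ⟨a, ha, b, hb, rfl⟩ := mem_sup.1 hw
  rw [mul_add, map_add, mem_perp.1 (hmem x hx).2 a ha, mem_perp.1 (hmem t ht).2 b hb, add_zero]

variable [Fintype F] [Fintype L]

local notation "q" => Fintype.card F

theorem card_perp (W : Submodule F L) [Fintype (perp W)] :
    Fintype.card (perp W) = q ^ (finrank F L - finrank F W) := by
  rw [Module.card_eq_pow_finrank (K := F), finrank_perp]

theorem sum_normSum_twistedTrace (hp : (finrank F L).Prime) (hp2 : 2 < finrank F L)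
    {ψ : AddChar F ℂ} (hψ : ψ ≠ 1) {n : F} (hn : ∀ s : F, s ^ 2 + s + n ≠ 0) (A : Submodule F L)
    [Fintype A] :
    ∑ c : L, normSum ψ n ((twistedTrace F c).restrict A) = (q : ℂ) ^ finrank F L := by
  classical
  simp only [normSum]
  rw [Finset.sum_comm]
  have hinner : ∀ v : A × A, ∑ c : L, ψ ((twistedTrace F c).restrict A v.1 v.1 +
      (twistedTrace F c).restrict A v.1 v.2 + n * (twistedTrace F c).restrict A v.2 v.2) =
      if v = 0 then (q : ℂ) ^ finrank F L else 0 := by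
    intro v
    set w : L := (v.1 : L) * v.1 + v.1 * v.2 + algebraMap F L n * (v.2 * v.2) with hw
    have hf : Algebra.trace F L ∘ₗ LinearMap.mulRight F w = 0 ↔ v = 0 := by
      have h0 : w = 0 ↔ v = 0 := by
        rw [hw, sq_add_mul_add_eq_zero_iff hp hp2 hn]
        simp [Prod.ext_iff]
      rw [← h0]
      refine ⟨fun h => (traceForm_nondegenerate F L).1 w fun y => ?_, fun h => by simp [h]⟩
      rw [Algebra.traceForm_apply, mul_comm]
      exact DFunLike.congr_fun h y
    have := sum_addChar_linearMap hψ (Algebra.trace F L ∘ₗ LinearMap.mulRight F w)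
    simp only [hf, Module.card_eq_pow_finrank (K := F) (V := L), Nat.cast_pow] at this
    rw [← this]
    refine Finset.sum_congr rfl fun c _ => congrArg ψ ?_
    simp only [LinearMap.BilinForm.restrict_apply, LinearMap.domRestrict_apply,
      twistedTrace_apply, LinearMap.comp_apply, LinearMap.mulRight_apply, hw]
    rw [← smul_eq_mul n, ← map_smul, ← map_add, ← map_add, Algebra.smul_def]
    congr 1
    ring
  rw [Finset.sum_congr rfl fun v _ => hinner v]
  simp

theorem sum_card_ker_twistedTrace (A : Submodule F L) [Fintype A] :
    ∑ c : L, q ^ finrank F (LinearMap.ker ((twistedTrace F c).restrict A)) =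
      q ^ finrank F L + (q ^ finrank F A - 1) * q ^ (finrank F L - finrank F A) := by
  classical
  have hker : ∀ c : L, q ^ finrank F (LinearMap.ker ((twistedTrace F c).restrict A)) =
      ∑ x : A, if c ∈ perp ((x : L) • A) then 1 else 0 := by
    intro c
    rw [← Module.card_eq_pow_finrank (K := F)
      (V := LinearMap.ker ((twistedTrace F c).restrict A)), Finset.sum_boole, Nat.cast_id,
      Fintype.card_subtype]
    simp only [LinearMap.mem_ker, restrict_twistedTrace_eq_zero_iff]
  have hperp : ∀ x : A, ∑ c : L, (if c ∈ perp ((x : L) • A) then 1 else 0) =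
      q ^ (finrank F L - finrank F ↥((x : L) • A)) := by
    intro x
    rw [Finset.sum_boole, Nat.cast_id, ← Fintype.card_subtype, card_perp]
  simp_rw [hker]
  rw [Finset.sum_comm]
  simp_rw [hperp]
  rw [← Finset.add_sum_erase _ _ (Finset.mem_univ (0 : A))]
  congr 1
  · have : ((0 : A) : L) • A = ⊥ := by
      rw [eq_bot_iff]
      rintro _ ⟨y, _, rfl⟩
      simp
    rw [this, finrank_bot, Nat.sub_zero]
  · rw [Finset.sum_congr rfl fun x hx => by
      rw [finrank_smul fun h => Finset.ne_of_mem_erase hx (Subtype.ext h)]]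
    rw [Finset.sum_const, Finset.card_erase_of_mem (Finset.mem_univ _), Finset.card_univ,
      Module.card_eq_pow_finrank (K := F) (V := A), smul_eq_mul]

theorem pow_identity_absurd {Q b k : ℕ} (hb : 2 ≤ b) (hk : 3 ≤ k) (hQ : 0 < Q)
    (h : ((b : ℤ) - 1) * (Q * b * (b ^ (k - 1)) ^ 2 - Q * (b ^ 2 * (b ^ (k - 1)) ^ 2)) =
      (-1) ^ k * (b * b ^ (k - 1)) * (2 * b * (Q * b * (b ^ (k - 1)) ^ 2 - Q) -
        (b + 1) * (Q * b * (b ^ (k - 1)) ^ 2 + (b * b ^ (k - 1) - 1) * (Q * b ^ (k - 1))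
          - Q * (b * b ^ (k - 1))))) : False := by
  have hu : (b : ℤ) < b ^ (k - 1) := by
    have : b ^ 1 < b ^ (k - 1) := Nat.pow_lt_pow_right hb (by omega)
    rw [pow_one] at this
    exact_mod_cast this
  generalize (b : ℤ) ^ (k - 1) = u at h hu
  have hb' : (2 : ℤ) ≤ b := by exact_mod_cast hb
  have hQ' : (0 : ℤ) < Q := by exact_mod_cast hQ
  generalize (b : ℤ) = b at h hu hb'
  have h0 : (Q : ℤ) * b * u ≠ 0 := by
    have : 0 < b := by omega
    have : 0 < u := by omega
    positivity
  rcases neg_one_pow_eq_or ℤ k with e | e <;> rw [e] at h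
  · have h1 : (Q : ℤ) * b * u * (2 * ((b * u - 1) * (u - b))) = 0 := by linear_combination h
    have h2 := (mul_eq_zero.1 h1).resolve_left h0
    have h3 : 0 < (b * u - 1) * (u - b) := mul_pos (by nlinarith) (by omega)
    omega
  · have h1 : (Q : ℤ) * b * u * (2 * b * (u - 1) ^ 2) = 0 := by linear_combination -h
    have h2 := (mul_eq_zero.1 h1).resolve_left h0
    have h3 : 0 < (u - 1) ^ 2 := pow_pos (by omega) 2
    have h4 : 0 < 2 * b * (u - 1) ^ 2 := by positivity
    omega

theorem not_vosperPair_self_of_sidon (hp : (finrank F L).Prime) {A : Submodule F L}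
    (hk : 3 ≤ finrank F A)
    (hsid : ∀ x ∉ (⊥ : Subalgebra F L), finrank F ↥(A ⊓ x • A) ≤ 1) : ¬ VosperPair A A := by
  classical
  intro hA
  obtain ⟨n, hn⟩ := exists_anisotropic F
  obtain ⟨ψ, hψ⟩ : ∃ ψ : AddChar F ℂ, ψ ≠ 1 :=
    ⟨AddChar.FiniteField.primitiveChar_to_Complex F, fun h =>
      AddChar.FiniteField.primitiveChar_to_Complex_isPrimitive F one_ne_zero (by simp [h])⟩
  obtain ⟨-, -, h3, h4⟩ := id hA
  have hAA := card_perp (A * A)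
  have hsum := sum_normSum_twistedTrace hp (by omega) hψ hn A
  have hker := sum_card_ker_twistedTrace A
  have hb : 2 ≤ q := Fintype.one_lt_card
  set k := finrank F A
  set r : L → ℕ := fun c => finrank F (LinearMap.ker ((twistedTrace F c).restrict A))
  replace hker : ∑ c, q ^ r c = _ := hker
  obtain ⟨m, hm⟩ : ∃ m, finrank F L = m + 2 * (k - 1) + 1 :=
    ⟨finrank F L - finrank F ↥(A * A), by omega⟩
  have hterm : ∀ c : L, (q - 1 : ℂ) * normSum ψ n ((twistedTrace F c).restrict A) -
      (-q : ℂ) ^ k * (2 * q - (q + 1) * ((q ^ r c : ℕ) : ℂ)) =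
      if c ∈ perp (A * A) then
        (q - 1 : ℂ) * q ^ (2 * k) - (-q : ℂ) ^ k * (2 * q - (q + 1) * q ^ k) else 0 := by
    intro c
    have hsymm := normSum_symmetric hψ hn ((twistedTrace F c).restrict A) fun x y => by
      simp only [LinearMap.BilinForm.restrict_apply, LinearMap.domRestrict_apply,
        twistedTrace_apply, mul_comm (x : L)]
    rw [hsymm]
    change (q - 1 : ℂ) * (q ^ (2 * r c) * (-q : ℂ) ^ (k - r c)) - _ = _
    split_ifs with hc
    · have hrc : r c = k := by
        have : LinearMap.ker ((twistedTrace F c).restrict A) = ⊤ := by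
          rw [LinearMap.ker_eq_top]
          ext x y
          exact mem_perp.1 hc _ (mul_mem_mul x.2 y.2)
        change finrank F (LinearMap.ker ((twistedTrace F c).restrict A)) = finrank F A
        rw [this, finrank_top]
      rw [hrc]
      simp
    · have hrc : r c ≤ 1 := finrank_ker_twistedTrace_le hA hsid hc
      interval_cases r c
      · simp
        ring
      · obtain ⟨j, hj⟩ : ∃ j, k = j + 1 := ⟨k - 1, by omega⟩
        rw [hj, Nat.add_sub_cancel]
        push_cast
        ring
  have hall := Finset.sum_congr (rfl : (Finset.univ : Finset L) = _) fun c _ => hterm c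
  rw [Finset.sum_sub_distrib, ← Finset.mul_sum, hsum, ← Finset.mul_sum, Finset.sum_sub_distrib,
    Finset.sum_const, ← Finset.mul_sum, ← Nat.cast_sum, hker, Finset.sum_ite, Finset.sum_const_zero,
    add_zero, Finset.sum_const, ← Fintype.card_subtype, hAA, Finset.card_univ,
    Module.card_eq_pow_finrank (K := F) (V := L)] at hall
  refine pow_identity_absurd (Q := q ^ m) hb hk (by positivity) ?_
  have e1 : finrank F L - finrank F ↥(A * A) = m := by omega
  have e2 : finrank F L - k = m + (k - 1) := by omega
  obtain ⟨j, hj⟩ : ∃ j, k = j + 1 := ⟨k - 1, by omega⟩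
  rw [e1, e2, hm, hj, Nat.add_sub_cancel] at hall
  rw [hj, Nat.add_sub_cancel]
  have hpos : 1 ≤ q ^ (j + 1) := Nat.one_le_pow _ _ (by omega)
  apply Int.cast_injective (α := ℂ)
  push_cast [hpos, nsmul_eq_mul] at hall ⊢
  rw [neg_pow] at hall
  linear_combination hall

end Counting

theorem VosperPair.exists_isProg {F L : Type*} [Field F] [Finite F] [Field L] [Algebra F L]
    [FiniteDimensional F L] (hp : (finrank F L).Prime) {S T : Submodule F L}
    (h : VosperPair S T) : ∃ x : L, IsProg x S ∧ IsProg x T := by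
  have := Fintype.ofFinite F
  have : Finite L := Module.finite_of_finite F
  have := Fintype.ofFinite L
  by_contra! hno
  obtain ⟨A, hA, hAA, hsid⟩ := IsBad.exists_self_pair hp (S := S)
    ⟨⟨T, h⟩, fun x hx hxS => hno x hxS (h.isProg hp hx hxS)⟩
  exact not_vosperPair_self_of_sidon hp hA hsid hAA

theorem IsProg.exists_basis {F L : Type*} [Field F] [Field L] [Algebra F L] {a : L}
    {S : Submodule F L} (h : IsProg a S) :
    ∃ g : L, ∃ b : Basis (Fin (finrank F S)) F S, ∀ i, (b i : L) = g * a ^ (i : ℕ) := by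
  obtain ⟨g, hg⟩ := h
  have hmem : ∀ i : Fin (finrank F S), g * a ^ (i : ℕ) ∈ S := fun i =>
    hg.ge (subset_span ⟨i, rfl⟩)
  refine ⟨g, basisOfTopLeSpanOfCardEqFinrank (fun i => ⟨g * a ^ (i : ℕ), hmem i⟩) ?_ (by simp),
    fun i => by rw [coe_basisOfTopLeSpanOfCardEqFinrank]⟩
  refine (map_le_map_iff_of_injective S.injective_subtype _ _).1 ?_
  rw [map_span, ← Set.range_comp, Submodule.map_top, range_subtype]
  exact hg.le

end LinearVosper

theorem stmt12 {F L : Type*} [Field F] [Fintype F] [Field L] [Algebra F L]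
    [FiniteDimensional F L]
    (p : ℕ) (hp : p.Prime) (hdeg : finrank F L = p)
    (S T : Submodule F L)
    (hS2 : 2 ≤ finrank F ↥S) (hT2 : 2 ≤ finrank F ↥T)
    (hST2 : finrank F ↥(S * T) ≤ p - 2)
    (hST : finrank F ↥(S * T) = finrank F ↥S + finrank F ↥T - 1) :
    ∃ g g' a : L,
      (∃ bS : Basis (Fin (finrank F ↥S)) F ↥S, ∀ i, (bS i : L) = g * a ^ (i : ℕ)) ∧
      (∃ bT : Basis (Fin (finrank F ↥T)) F ↥T, ∀ i, (bT i : L) = g' * a ^ (i : ℕ)) := by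
  subst hdeg
  obtain ⟨a, hS, hT⟩ := LinearVosper.VosperPair.exists_isProg hp (S := S) (T := T)
    ⟨hS2, hT2, by omega, by omega⟩
  obtain ⟨g, hg⟩ := hS.exists_basis
  obtain ⟨g', hg'⟩ := hT.exists_basis
  exact ⟨g, g', a, hg, hg'⟩
end
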